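/- arXiv:2209.15114 — 2 statements merged into one kernel-verified Lean document; each statement's English description precedes it below -/
import Mathlib

section
/- For every n ∈ ℕ₀, spt(5n+4) ≡ 0 (mod 5) and spt(7n+5) ≡ 0 (mod 7). -/
open Finset

open scoped Classical in
/-- `spt n` is the total number of smallest parts among all the integer partitions of `n`,
i.e. the sum over all partitions `π` of `n` of the multiplicity of the smallest part of
`π` (an empty partition contributes `0`). -/
noncomputable def spt (n : ℕ) : ℕ :=
  ∑ π : Nat.Partition n, Multiset.card (π.parts.filter (fun a => ∀ b ∈ π.parts, a ≤ b))

namespace SptCongruences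

section Basic

open PowerSeries

variable {k : Type*} [Field k]

/-- The derivation `X d/dX` on power series. -/
noncomputable def theta : Derivation k k⟦X⟧ k⟦X⟧ := (X : k⟦X⟧) • PowerSeries.derivative k

/-- The geometric series `1 / (1 - X ^ n)`. -/
noncomputable def geom (k : Type*) [Field k] (n : ℕ) : k⟦X⟧ := (1 - X ^ n)⁻¹

/-- The series `(1 + X ^ n) / (1 - X ^ n)`. -/
noncomputable def coth (k : Type*) [Field k] (n : ℕ) : k⟦X⟧ := (1 + X ^ n) * geom k n

/-- The series `X ^ n / (1 - X ^ n) ^ 2`. -/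
noncomputable def lam (k : Type*) [Field k] (n : ℕ) : k⟦X⟧ := X ^ n * geom k n ^ 2

lemma coeff_theta (f : k⟦X⟧) (n : ℕ) : coeff n (theta f) = n * coeff n f := by
  rw [theta, Derivation.smul_apply, smul_eq_mul]
  cases n with
  | zero => simp
  | succ n =>
    rw [coeff_succ_X_mul, coeff_derivative]
    push_cast
    ring

lemma theta_X_pow (n : ℕ) : theta (X ^ n : k⟦X⟧) = (n : k⟦X⟧) * X ^ n := by
  ext m
  rw [coeff_theta, ← map_natCast (C (R := k)) n, coeff_C_mul, coeff_X_pow]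
  split_ifs with h <;> simp [h]

lemma theta_natCast (n : ℕ) : theta (n : k⟦X⟧) = 0 := Derivation.map_natCast _ _

lemma X_pow_dvd_theta {M : ℕ} {f : k⟦X⟧} (h : X ^ M ∣ f) : X ^ M ∣ theta f := by
  obtain ⟨g, rfl⟩ := h
  rw [Derivation.leibniz, theta_X_pow]
  exact ⟨theta g + (M : k⟦X⟧) * g, by simp only [smul_eq_mul]; ring⟩

lemma one_sub_mul_geom {n : ℕ} (hn : n ≠ 0) : (1 - X ^ n) * geom k n = 1 :=
  PowerSeries.mul_inv_cancel _ (by simp [hn])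

lemma one_sub_X_pow_ne_zero {n : ℕ} (hn : n ≠ 0) : (1 - X ^ n : k⟦X⟧) ≠ 0 :=
  left_ne_zero_of_mul_eq_one (one_sub_mul_geom hn)

lemma coth_sq {n : ℕ} (hn : n ≠ 0) : coth k n ^ 2 = 1 + 4 * lam k n := by
  have h := one_sub_mul_geom (k := k) hn
  rw [coth, lam]
  linear_combination ((1 - X ^ n) * geom k n + 1) * h

lemma coth_mul_coth {i j : ℕ} (hi : i ≠ 0) (hj : j ≠ 0) :
    coth k i * coth k j + 1 = coth k (i + j) * (coth k i + coth k j) := by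
  have h1 := one_sub_mul_geom (k := k) hi
  have h2 := one_sub_mul_geom (k := k) hj
  have h3 := one_sub_mul_geom (k := k) (n := i + j) (by omega)
  have key : (1 - X ^ (i + j)) * (coth k i * coth k j + 1) =
      (1 - X ^ (i + j)) * (coth k (i + j) * (coth k i + coth k j)) := by
    have e1 : (1 - X ^ i) * coth k i = 1 + X ^ i := by
      rw [coth]; linear_combination (1 + X ^ i) * h1
    have e2 : (1 - X ^ j) * coth k j = 1 + X ^ j := by
      rw [coth]; linear_combination (1 + X ^ j) * h2
    have e3 : (1 - X ^ (i + j)) * coth k (i + j) = 1 + X ^ (i + j) := by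
      rw [coth]; linear_combination (1 + X ^ (i + j)) * h3
    apply mul_left_cancel₀ (one_sub_X_pow_ne_zero (k := k) hi)
    apply mul_left_cancel₀ (one_sub_X_pow_ne_zero (k := k) hj)
    rw [pow_add] at e3 ⊢
    linear_combination
      (1 - X ^ i * X ^ j) * ((1 - X ^ j) * coth k j * e1 + (1 + X ^ i) * e2)
      - (1 - X ^ i) * (1 - X ^ j) * (coth k i + coth k j) * e3
      - (1 + X ^ i * X ^ j) * ((1 - X ^ j) * e1 + (1 - X ^ i) * e2)
  exact mul_left_cancel₀ (one_sub_X_pow_ne_zero (by omega)) key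

lemma theta_geom {n : ℕ} (hn : n ≠ 0) : theta (geom k n) = (n : k⟦X⟧) * X ^ n * geom k n ^ 2 := by
  have h := one_sub_mul_geom (k := k) hn
  have h' := congrArg theta h
  rw [Derivation.leibniz, map_sub, Derivation.map_one_eq_zero, theta_X_pow] at h'
  simp only [smul_eq_mul] at h'
  linear_combination geom k n * h' - theta (geom k n) * h

lemma theta_pow (f : k⟦X⟧) (n : ℕ) : theta (f ^ (n + 1)) = (n + 1) * f ^ n * theta f := by
  rw [Derivation.leibniz_pow]
  simp [smul_eq_mul, mul_assoc]

lemma theta_mul (f g : k⟦X⟧) : theta (f * g) = f * theta g + g * theta f := by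
  rw [Derivation.leibniz, smul_eq_mul, smul_eq_mul]

lemma theta_lam {n : ℕ} (hn : n ≠ 0) : theta (lam k n) = (n : k⟦X⟧) * coth k n * lam k n := by
  have h := one_sub_mul_geom (k := k) hn
  have h2 := theta_pow (geom k n) 1
  rw [lam, theta_mul, h2, theta_geom hn, theta_X_pow, coth]
  push_cast
  linear_combination -(n : k⟦X⟧) * X ^ n * geom k n ^ 2 * h

lemma X_pow_dvd_lam (n : ℕ) : X ^ n ∣ lam k n := Dvd.intro _ rfl

lemma X_pow_dvd_coth_sub_one {n : ℕ} (hn : n ≠ 0) : X ^ n ∣ coth k n - 1 := by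
  have h := one_sub_mul_geom (k := k) hn
  exact ⟨2 * geom k n, by rw [coth]; linear_combination h⟩

end Basic

section Rho

open PowerSeries

variable {k : Type*} [Field k]

/-- The difference `± coth |m - n| - coth (m + n)`, with the sign of `m - n`. -/
noncomputable def cothDiff (k : Type*) [Field k] (n m : ℕ) : k⟦X⟧ :=
  if m = n then 0 else
    (if m < n then -coth k (n - m) else coth k (m - n)) - coth k (n + m)

/-- The quotient `lam m / (lam n - lam m)`, as a power series. -/
noncomputable def rho (k : Type*) [Field k] (n m : ℕ) : k⟦X⟧ :=
  cothDiff k n m * (2 * coth k n)⁻¹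

lemma cothDiff_self (n : ℕ) : cothDiff k n n = 0 := by simp [cothDiff]

lemma rho_self (n : ℕ) : rho k n n = 0 := by simp [rho, cothDiff_self]

lemma constantCoeff_two_mul_coth (h2 : (2 : k) ≠ 0) {n : ℕ} (hn : n ≠ 0) :
    constantCoeff (2 * coth k n) ≠ 0 := by
  have : constantCoeff (coth k n) = 1 := by simp [coth, geom, hn]
  rw [map_mul, this, map_ofNat, mul_one]
  exact h2

lemma two_mul_coth_mul_rho (h2 : (2 : k) ≠ 0) {n : ℕ} (hn : n ≠ 0) (m : ℕ) :
    2 * coth k n * rho k n m = cothDiff k n m := by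
  have h := PowerSeries.mul_inv_cancel _ (constantCoeff_two_mul_coth h2 hn)
  rw [rho]
  linear_combination cothDiff k n m * h

lemma two_mul_coth_ne_zero (h2 : (2 : k) ≠ 0) {n : ℕ} (hn : n ≠ 0) : 2 * coth k n ≠ 0 :=
  left_ne_zero_of_mul_eq_one
    (PowerSeries.mul_inv_cancel _ (constantCoeff_two_mul_coth h2 hn))

lemma coth_sq_sub_one {n : ℕ} (hn : n ≠ 0) : 4 * lam k n = coth k n ^ 2 - 1 := by
  rw [coth_sq hn]; ring

lemma four_ne_zero_of_two (h2 : (2 : k) ≠ 0) : (4 : k⟦X⟧) ≠ 0 := by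
  intro h
  have := congrArg constantCoeff h
  rw [map_ofNat, map_zero] at this
  exact mul_self_ne_zero.mpr h2 (by linear_combination this)

lemma rho_mul_sub (h2 : (2 : k) ≠ 0) {n m : ℕ} (hn : n ≠ 0) (hm : m ≠ 0) (h : n ≠ m) :
    rho k n m * (lam k n - lam k m) = lam k m := by
  have hr := two_mul_coth_mul_rho h2 hn m
  have h4 := four_ne_zero_of_two h2
  apply mul_left_cancel₀ h4
  apply mul_left_cancel₀ (two_mul_coth_ne_zero h2 hn)
  have e1 := coth_sq_sub_one (k := k) hn
  have e2 := coth_sq_sub_one (k := k) hm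
  have e3 := coth_mul_coth (k := k) hn hm
  have key : cothDiff k n m * (coth k n - coth k m) * (coth k n + coth k m) =
      2 * coth k n * (coth k m ^ 2 - 1) := by
    rw [cothDiff, if_neg (by omega)]
    split_ifs with hlt
    · have e4 := coth_mul_coth (k := k) hm (j := n - m) (by omega)
      rw [show m + (n - m) = n by omega] at e4
      linear_combination (coth k n + coth k m) * e4 + (coth k n - coth k m) * e3
    · have e4 := coth_mul_coth (k := k) hn (j := m - n) (by omega)
      rw [show n + (m - n) = m by omega] at e4
      linear_combination (coth k n + coth k m) * e4 + (coth k n - coth k m) * e3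
  linear_combination key + (coth k n ^ 2 - coth k m ^ 2) * hr +
    2 * coth k n * rho k n m * (e1 - e2) - 2 * coth k n * e2

lemma lam_ne_zero {n : ℕ} (hn : n ≠ 0) : lam k n ≠ 0 :=
  mul_ne_zero (pow_ne_zero _ X_ne_zero)
    (pow_ne_zero _ (right_ne_zero_of_mul_eq_one (one_sub_mul_geom hn)))

lemma lam_ne_lam (h2 : (2 : k) ≠ 0) {n m : ℕ} (hn : n ≠ 0) (hm : m ≠ 0) (h : n ≠ m) :
    lam k n ≠ lam k m := by
  intro he
  have := rho_mul_sub h2 hn hm h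
  rw [he, sub_self, mul_zero] at this
  exact lam_ne_zero hm this.symm

lemma rho_swap (h2 : (2 : k) ≠ 0) {n m : ℕ} (hn : n ≠ 0) (hm : m ≠ 0) (h : n ≠ m) :
    rho k m n = -1 - rho k n m := by
  apply mul_right_cancel₀ (sub_ne_zero.mpr (lam_ne_lam h2 hm hn h.symm))
  linear_combination rho_mul_sub h2 hm hn h.symm - rho_mul_sub h2 hn hm h

end Rho

section Telescope

variable {M : Type*} [AddCommGroup M]

lemma sum_Icc_one_sub (f : ℕ → M) (l : ℕ) :
    ∑ m ∈ Icc 1 l, f (l + 1 - m) = ∑ j ∈ Icc 1 l, f j := by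
  refine Finset.sum_nbij' (fun m => l + 1 - m) (fun m => l + 1 - m) ?_ ?_ ?_ ?_ ?_ <;>
    simp only [Finset.mem_Icc] <;> intros <;> first | omega | trivial

lemma sum_Icc_abs_sub (f g : ℕ → M) (l K : ℕ) :
    ∑ m ∈ Icc 1 (l + 1 + K), (if m = l + 1 then 0 else
      if m < l + 1 then f (l + 1 - m) else g (m - (l + 1))) =
      ∑ j ∈ Icc 1 l, f j + ∑ j ∈ Icc 1 K, g j := by
  induction K with
  | zero =>
    rw [add_zero, Finset.sum_Icc_succ_top (by omega), if_pos rfl, ← sum_Icc_one_sub f l]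
    simp only [add_zero, zero_lt_one, Finset.Icc_eq_empty_of_lt, Finset.sum_empty]
    refine Finset.sum_congr rfl fun m hm => ?_
    rw [Finset.mem_Icc] at hm
    rw [if_neg (by omega), if_pos (by omega)]
  | succ K ih =>
    rw [← add_assoc, Finset.sum_Icc_succ_top (by omega), ih,
      Finset.sum_Icc_succ_top (by omega : 1 ≤ K + 1), if_neg (by omega), if_neg (by omega),
      add_assoc, show l + 1 + K + 1 - (l + 1) = K + 1 by omega]

lemma sum_Icc_add (f : ℕ → M) (n N : ℕ) :
    ∑ m ∈ Icc 1 N, f (n + m) = ∑ j ∈ Icc 1 (n + N), f j - ∑ j ∈ Icc 1 n, f j := by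
  induction N with
  | zero => simp
  | succ N ih =>
    rw [Finset.sum_Icc_succ_top (by omega), ih, ← add_assoc,
      Finset.sum_Icc_succ_top (by omega)]
    abel

end Telescope

section RhoSums

open PowerSeries

variable {k : Type*} [Field k]

/-- The power sums of the series `lam n` with `1 ≤ n ≤ N`. -/
noncomputable def psum (k : Type*) [Field k] (N j : ℕ) : k⟦X⟧ := ∑ n ∈ Icc 1 N, lam k n ^ j

lemma dvd_sum_Icc_add_sub {f : ℕ → k⟦X⟧} {c : k⟦X⟧} (h : ∀ j, j ≠ 0 → X ^ j ∣ f j - c)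
    (K L : ℕ) :
    X ^ (K + 1) ∣ (∑ j ∈ Icc 1 (K + L), f j - ∑ j ∈ Icc 1 K, f j) - (L : k⟦X⟧) * c := by
  induction L with
  | zero => simp
  | succ L ih =>
    rw [← add_assoc, Finset.sum_Icc_succ_top (by omega)]
    have := dvd_add ih ((pow_dvd_pow X (by omega : K + 1 ≤ K + L + 1)).trans
      (h (K + L + 1) (by omega)))
    convert this using 1
    push_cast
    ring

lemma sum_cothDiff (n K : ℕ) (hn : n ≠ 0) :
    X ^ (K + 1) ∣ ∑ m ∈ Icc 1 (n + K), cothDiff k n m -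
      (coth k n + coth k (2 * n) - 2 * (n : k⟦X⟧)) := by
  obtain ⟨l, rfl⟩ := Nat.exists_eq_succ_of_ne_zero hn
  simp only [Nat.succ_eq_add_one] at *
  have e : ∀ m ∈ Icc 1 (l + 1 + K), cothDiff k (l + 1) m =
      (if m = l + 1 then 0 else
      if m < l + 1 then -coth k (l + 1 - m) else coth k (m - (l + 1)))
      - coth k (l + 1 + m) + if l + 1 = m then coth k (2 * (l + 1)) else 0 := by
    intro m _
    rw [cothDiff]
    by_cases h : m = l + 1
    · simp [h, two_mul]
    · rw [if_neg h, if_neg h, if_neg (Ne.symm h), add_zero]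
  rw [Finset.sum_congr rfl e, Finset.sum_add_distrib, Finset.sum_sub_distrib,
    sum_Icc_abs_sub (fun j => -coth k j) (coth k), sum_Icc_add (coth k), Finset.sum_ite_eq,
    if_pos (by simp), Finset.sum_neg_distrib]
  have h := dvd_sum_Icc_add_sub (k := k) (fun j hj => X_pow_dvd_coth_sub_one hj) K
    (2 * (l + 1))
  rw [show l + 1 + (l + 1 + K) = K + 2 * (l + 1) by omega,
    Finset.sum_Icc_succ_top (by omega : 1 ≤ l + 1)]
  rw [← dvd_neg] at h
  convert h using 1
  push_cast
  ring

lemma sum_cothDiff_sq (n K : ℕ) (hn : n ≠ 0) :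
    X ^ (K + 1) ∣ ∑ m ∈ Icc 1 (n + K), cothDiff k n m ^ 2 -
      (4 * (2 * psum k (n + K) 1 - lam k n - lam k (2 * n)) -
        2 * coth k (2 * n) * ∑ m ∈ Icc 1 (n + K), cothDiff k n m) := by
  obtain ⟨l, rfl⟩ := Nat.exists_eq_succ_of_ne_zero hn
  simp only [Nat.succ_eq_add_one] at *
  have e : ∀ m ∈ Icc 1 (l + 1 + K), cothDiff k (l + 1) m ^ 2 =
      4 * ((if m = l + 1 then 0 else
      if m < l + 1 then lam k (l + 1 - m) else lam k (m - (l + 1)))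
      + lam k (l + 1 + m) - if l + 1 = m then lam k (2 * (l + 1)) else 0)
      - 2 * coth k (2 * (l + 1)) * cothDiff k (l + 1) m := by
    intro m hm
    rw [Finset.mem_Icc] at hm
    rw [cothDiff]
    by_cases h : m = l + 1
    · simp [h, two_mul]
    · rw [if_neg h, if_neg h, if_neg (Ne.symm h), sub_zero]
      have e1 := coth_sq (k := k) (n := l + 1 + m) (by omega)
      split_ifs with hlt
      · have e2 := coth_sq (k := k) (n := l + 1 - m) (by omega)
        have e3 := coth_mul_coth (k := k) (i := l + 1 + m) (j := l + 1 - m) (by omega) (by omega)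
        rw [show l + 1 + m + (l + 1 - m) = 2 * (l + 1) by omega] at e3
        linear_combination e1 + e2 + 2 * e3
      · have e2 := coth_sq (k := k) (n := m - (l + 1)) (by omega)
        have e3 := coth_mul_coth (k := k) (i := m - (l + 1)) (j := 2 * (l + 1))
          (by omega) (by omega)
        rw [show m - (l + 1) + 2 * (l + 1) = l + 1 + m by omega] at e3
        linear_combination e1 + e2 + 2 * e3
  rw [Finset.sum_congr rfl e, Finset.sum_sub_distrib, ← Finset.mul_sum, ← Finset.mul_sum,
    Finset.sum_sub_distrib, Finset.sum_add_distrib,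
    sum_Icc_abs_sub (lam k) (lam k), sum_Icc_add (lam k), Finset.sum_ite_eq,
    if_pos (by simp)]
  have hx : ∀ j, j ≠ 0 → (X : k⟦X⟧) ^ j ∣ lam k j - 0 := fun j _ => by
    rw [sub_zero]; exact X_pow_dvd_lam j
  have h1 := dvd_sum_Icc_add_sub (k := k) hx (l + 1 + K) (l + 1)
  have h2 := dvd_sum_Icc_add_sub (k := k) hx K (l + 1)
  rw [mul_zero, sub_zero] at h1 h2
  have h1' := (pow_dvd_pow (X : k⟦X⟧) (by omega : K + 1 ≤ l + 1 + K + 1)).trans h1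
  have h3 := dvd_sub (dvd_mul_of_dvd_right h1' 4) (dvd_mul_of_dvd_right h2 4)
  rw [add_comm (l + 1) (l + 1 + K), Finset.sum_Icc_succ_top (by omega : 1 ≤ l + 1)]
  convert h3 using 1
  simp only [psum, pow_one]
  rw [add_comm K (l + 1)]
  ring

end RhoSums

section Alpha

open PowerSeries

variable {k : Type*} [Field k]

/-- The finite product `∏ (1 - X ^ m)` over `1 ≤ m ≤ n`. -/
noncomputable def qPoch (k : Type*) [Field k] (n : ℕ) : k⟦X⟧ := ∏ m ∈ Icc 1 n, (1 - X ^ m)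

/-- The product of the quotients `lam n / (lam n - lam m)` over `m ≤ N` with `m ≠ n`. -/
noncomputable def alpha (k : Type*) [Field k] (N n : ℕ) : k⟦X⟧ :=
  ∏ m ∈ Icc 1 N, (1 + rho k n m)

lemma qPoch_zero : qPoch k 0 = 1 := by simp [qPoch]

lemma qPoch_succ (n : ℕ) : qPoch k (n + 1) = qPoch k n * (1 - X ^ (n + 1)) :=
  Finset.prod_Icc_succ_top (by omega) _

lemma qPoch_ne_zero (n : ℕ) : qPoch k n ≠ 0 :=
  Finset.prod_ne_zero_iff.mpr fun m hm =>
    one_sub_X_pow_ne_zero (by rw [Finset.mem_Icc] at hm; omega)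

lemma one_sub_sq_mul_lam {n : ℕ} (hn : n ≠ 0) : (1 - X ^ n) ^ 2 * lam k n = X ^ n := by
  have h := one_sub_mul_geom (k := k) hn
  rw [lam]
  linear_combination X ^ n * ((1 - X ^ n) * geom k n + 1) * h

lemma one_add_rho_mul (h2 : (2 : k) ≠ 0) {n m : ℕ} (hn : n ≠ 0) (hm : m ≠ 0) (h : n ≠ m) :
    (1 + rho k n m) * (X ^ n - X ^ m) * (1 - X ^ (n + m)) = X ^ n * (1 - X ^ m) ^ 2 := by
  have e0 := rho_mul_sub h2 hn hm h
  have e1 := one_sub_sq_mul_lam (k := k) hn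
  have e2 := one_sub_sq_mul_lam (k := k) hm
  rw [pow_add]
  linear_combination (1 - X ^ n) ^ 2 * (1 - X ^ m) ^ 2 * e0 +
    rho k n m * ((1 - X ^ n) ^ 2 * e2 - (1 - X ^ m) ^ 2 * e1) + (1 - X ^ n) ^ 2 * e2

lemma one_add_rho_mul_of_gt (h2 : (2 : k) ≠ 0) {n d : ℕ} (hn : n ≠ 0) (hd : d ≠ 0) :
    (1 + rho k n (n + d)) * (1 - X ^ d) * (1 - X ^ (2 * n + d)) = (1 - X ^ (n + d)) ^ 2 := by
  have h := one_add_rho_mul h2 hn (m := n + d) (by omega) (by omega)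
  apply mul_left_cancel₀ (pow_ne_zero n (X_ne_zero (R := k)))
  rw [← h, show n + (n + d) = 2 * n + d by omega, pow_add X n d]
  ring

lemma one_add_rho_mul_of_lt (h2 : (2 : k) ≠ 0) {m d : ℕ} (hm : m ≠ 0) (hd : d ≠ 0) :
    (1 + rho k (m + d) m) * (1 - X ^ d) * (1 - X ^ (2 * m + d)) =
      -X ^ d * (1 - X ^ m) ^ 2 := by
  have h := one_add_rho_mul h2 (n := m + d) (by omega) hm (by omega)
  apply mul_left_cancel₀ (pow_ne_zero m (X_ne_zero (R := k)))
  rw [show m + d + m = 2 * m + d by omega, pow_add X m d] at h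
  linear_combination -h

lemma prod_one_add_rho_of_lt (h2 : (2 : k) ≠ 0) (n M : ℕ) : ∀ L, n = M + 1 + L →
    (∏ m ∈ Icc 1 M, (1 + rho k n m)) * qPoch k (M + L) * qPoch k (n + M) =
      (-1) ^ M * X ^ (∑ m ∈ Icc 1 M, (n - m)) * qPoch k M ^ 2 * qPoch k L * qPoch k n := by
  induction M with
  | zero => intro L h; simp [qPoch_zero]
  | succ M ih =>
    intro L h
    have h1 := ih (L + 1) (by omega)
    have h3 := one_add_rho_mul_of_lt h2 (m := M + 1) (d := L + 1) (by omega) (by omega)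
    rw [show M + 1 + (L + 1) = n by omega,
      show 2 * (M + 1) + (L + 1) = n + M + 1 by omega] at h3
    apply mul_left_cancel₀ (one_sub_X_pow_ne_zero (k := k) (n := L + 1) (by omega))
    rw [Finset.prod_Icc_succ_top (by omega), Finset.sum_Icc_succ_top (by omega),
      ← add_assoc n M 1, qPoch_succ, qPoch_succ, pow_add X, show n - (M + 1) = L + 1 by omega,
      show M + 1 + L = M + (L + 1) by omega, pow_succ (-1 : k⟦X⟧)]
    rw [qPoch_succ L] at h1
    linear_combination (1 + rho k n (M + 1)) * (1 - X ^ (L + 1)) * (1 - X ^ (n + M + 1)) * h1 +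
      (-1) ^ M * X ^ (∑ m ∈ Icc 1 M, (n - m)) * qPoch k M ^ 2 * (qPoch k L *
        (1 - X ^ (L + 1))) * qPoch k n * h3

lemma sum_Icc_one_id (l : ℕ) : ∑ m ∈ Icc 1 l, m = (l + 1).choose 2 := by
  induction l with
  | zero => rfl
  | succ l ih =>
    rw [Finset.sum_Icc_succ_top (by omega), ih, Nat.choose_succ_succ (l + 1) 1,
      Nat.choose_one_right,
      add_comm]

lemma alpha_mul_qPoch (h2 : (2 : k) ≠ 0) (l K : ℕ) :
    alpha k (l + 1 + K) (l + 1) * (qPoch k K * qPoch k (2 * (l + 1) + K)) =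
      (-1) ^ l * X ^ (l + 1).choose 2 * (1 + X ^ (l + 1)) * qPoch k (l + 1 + K) ^ 2 := by
  induction K with
  | zero =>
    have h := prod_one_add_rho_of_lt h2 (l + 1) l 0 (by omega)
    have e : ∑ m ∈ Icc 1 l, (l + 1 - m) = (l + 1).choose 2 := by
      have : ∑ m ∈ Icc 1 l, (l + 1 - m) = ∑ m ∈ Icc 1 l, m := by
        refine Finset.sum_nbij' (fun m => l + 1 - m) (fun m => l + 1 - m) ?_ ?_ ?_ ?_ ?_ <;>
          simp only [Finset.mem_Icc] <;> intros <;> first | omega | trivial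
      rw [this, sum_Icc_one_id]
    rw [e] at h
    apply mul_left_cancel₀ (qPoch_ne_zero (k := k) l)
    rw [alpha, add_zero, Finset.prod_Icc_succ_top (by omega), rho_self,
      show 2 * (l + 1) + 0 = l + 1 + l + 1 by omega, qPoch_succ (l + 1 + l), qPoch_zero,
      show l + 1 + l + 1 = (l + 1) + (l + 1) by omega, pow_add X (l + 1) (l + 1)]
    rw [qPoch_zero, add_zero] at h
    rw [qPoch_succ l] at h ⊢
    linear_combination (1 - X ^ (l + 1) * X ^ (l + 1)) * h
  | succ K ih =>
    have h3 := one_add_rho_mul_of_gt h2 (n := l + 1) (d := K + 1) (by omega) (by omega)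
    rw [← add_assoc (l + 1) K 1, ← add_assoc (2 * (l + 1)) K 1] at h3 ⊢
    rw [alpha] at ih ⊢
    rw [Finset.prod_Icc_succ_top (by omega), qPoch_succ, qPoch_succ, qPoch_succ]
    linear_combination (1 + rho k (l + 1) (l + 1 + K + 1)) * (1 - X ^ (K + 1)) *
      (1 - X ^ (2 * (l + 1) + K + 1)) * ih + (-1) ^ l * X ^ (l + 1).choose 2 *
      (1 + X ^ (l + 1)) * qPoch k (l + 1 + K) ^ 2 * h3

lemma dvd_qPoch_add_sub (K L : ℕ) : X ^ (K + 1) ∣ qPoch k (K + L) - qPoch k K := by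
  induction L with
  | zero => simp
  | succ L ih =>
    rw [← add_assoc, qPoch_succ]
    obtain ⟨c, hc⟩ := ih
    exact ⟨c - X ^ L * qPoch k (K + L), by
      rw [show K + L + 1 = (K + 1) + L by omega, pow_add X (K + 1) L]; linear_combination hc⟩

lemma isUnit_qPoch (n : ℕ) : IsUnit (qPoch k n) := by
  rw [PowerSeries.isUnit_iff_constantCoeff]
  have : constantCoeff (qPoch k n) = 1 := by
    rw [qPoch, map_prod]
    refine Finset.prod_eq_one fun m hm => ?_
    rw [Finset.mem_Icc] at hm
    simp [show m ≠ 0 by omega]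
  simp [this]

lemma alpha_congr (h2 : (2 : k) ≠ 0) (l K : ℕ) :
    X ^ (K + 1) ∣ alpha k (l + 1 + K) (l + 1) -
      (-1) ^ l * X ^ (l + 1).choose 2 * (1 + X ^ (l + 1)) := by
  have h := alpha_mul_qPoch h2 l K
  obtain ⟨a, ha⟩ := dvd_qPoch_add_sub (k := k) K (l + 1)
  obtain ⟨b, hb⟩ := dvd_qPoch_add_sub (k := k) K (2 * (l + 1))
  rw [add_comm K] at ha hb
  rw [← (isUnit_qPoch (k := k) K).dvd_mul_left,
    ← (isUnit_qPoch (k := k) (2 * (l + 1) + K)).dvd_mul_left]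
  set g : k⟦X⟧ := (-1) ^ l * X ^ (l + 1).choose 2 * (1 + X ^ (l + 1)) with hg
  exact ⟨g * (a * (qPoch k (l + 1 + K) + qPoch k K) - qPoch k K * b), by
    linear_combination h + g * (qPoch k (l + 1 + K) + qPoch k K) * ha - g * qPoch k K * hb⟩

end Alpha

section PartialFractions


lemma exists_prod_one_add_mul {S : Type*} [CommRing S] (s : Finset ℕ) (r : ℕ → S) (Y : S) :
    ∃ e z, 2 * e = (∑ m ∈ s, r m) ^ 2 - ∑ m ∈ s, r m ^ 2 ∧
      ∏ m ∈ s, (1 + r m * Y) = 1 + (∑ m ∈ s, r m) * Y + e * Y ^ 2 + z * Y ^ 3 := by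
  induction s using Finset.cons_induction with
  | empty => exact ⟨0, 0, by simp, by simp⟩
  | cons a s ha ih =>
    obtain ⟨e, z, h1, h2⟩ := ih
    refine ⟨e + r a * ∑ m ∈ s, r m, z + r a * e + r a * z * Y, ?_, ?_⟩
    · rw [Finset.sum_cons, Finset.sum_cons]
      linear_combination h1
    · rw [Finset.prod_cons, Finset.sum_cons, h2]
      ring

lemma dvd_cube_prod_one_add_mul {S : Type*} [CommRing S] (s : Finset ℕ) (r : ℕ → S) (Y : S) :
    Y ^ 3 ∣ (∏ m ∈ s, (1 + r m * Y)) ^ 3 * (2 - 6 * (∑ m ∈ s, r m) * Y +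
      (9 * (∑ m ∈ s, r m) ^ 2 + 3 * ∑ m ∈ s, r m ^ 2) * Y ^ 2) - 2 := by
  obtain ⟨e, z, h1, h2⟩ := exists_prod_one_add_mul s r Y
  rw [h2]
  set a := ∑ m ∈ s, r m
  have h3 : ∑ m ∈ s, r m ^ 2 = a ^ 2 - 2 * e := by linear_combination h1
  rw [h3]
  have h4 : (1 + a * Y + e * Y ^ 2 + z * Y ^ 3) ^ 3 =
      1 + 3 * a * Y + (3 * a ^ 2 + 3 * e) * Y ^ 2 +
      (a ^ 3 + 6 * a * e + Y * (3 * a ^ 2 * e + 3 * e ^ 2) + 3 * a * e ^ 2 * Y ^ 2 +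
        e ^ 3 * Y ^ 3 + z * (3 * (1 + a * Y + e * Y ^ 2) ^ 2 +
          3 * (1 + a * Y + e * Y ^ 2) * (z * Y ^ 3) + (z * Y ^ 3) ^ 2)) * Y ^ 3 := by ring
  rw [h4]
  set w := a ^ 3 + 6 * a * e + Y * (3 * a ^ 2 * e + 3 * e ^ 2) + 3 * a * e ^ 2 * Y ^ 2 +
        e ^ 3 * Y ^ 3 + z * (3 * (1 + a * Y + e * Y ^ 2) ^ 2 +
          3 * (1 + a * Y + e * Y ^ 2) * (z * Y ^ 3) + (z * Y ^ 3) ^ 2)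
  refine ⟨w * (2 - 6 * a * Y + (9 * a ^ 2 + 3 * (a ^ 2 - 2 * e)) * Y ^ 2) +
    3 * a * (9 * a ^ 2 + 3 * (a ^ 2 - 2 * e)) - 6 * a * (3 * a ^ 2 + 3 * e) +
    (3 * a ^ 2 + 3 * e) * (9 * a ^ 2 + 3 * (a ^ 2 - 2 * e)) * Y, by ring⟩

open Polynomial

variable {F : Type*} [Field F]

lemma isCoprime_one_sub_C_mul_X {a b : F} (h : a ≠ b) :
    IsCoprime (1 - C a * X : F[X]) (1 - C b * X) := by
  refine ⟨-C ((a - b)⁻¹ * b), C ((a - b)⁻¹ * a), ?_⟩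
  have h1 : (a - b)⁻¹ * (a - b) = 1 := inv_mul_cancel₀ (sub_ne_zero.mpr h)
  have h2 := congrArg (C : F → F[X]) h1
  simp only [map_mul, map_sub, map_one] at h2 ⊢
  linear_combination h2

lemma hermite_partial_fractions (s : Finset ℕ) (hs : s.Nonempty) (y : ℕ → F)
    (hy0 : ∀ n ∈ s, y n ≠ 0) (hy : ∀ n ∈ s, ∀ m ∈ s, n ≠ m → y n ≠ y m) (r : ℕ → ℕ → F)
    (hr0 : ∀ n ∈ s, r n n = 0)
    (hr : ∀ n ∈ s, ∀ m ∈ s, n ≠ m → r n m * (y n - y m) = y m) :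
    ∑ n ∈ s, C ((∏ m ∈ s, (1 + r n m)) ^ 3) * (2 - C (6 * ∑ m ∈ s, r n m) * (1 - C (y n) * X) +
      C (9 * (∑ m ∈ s, r n m) ^ 2 + 3 * ∑ m ∈ s, r n m ^ 2) * (1 - C (y n) * X) ^ 2) *
      ∏ m ∈ s.erase n, (1 - C (y m) * X) ^ 3 = (2 : F[X]) := by
  set W := ∑ n ∈ s, C ((∏ m ∈ s, (1 + r n m)) ^ 3) * (2 - C (6 * ∑ m ∈ s, r n m) *
    (1 - C (y n) * X) +
      C (9 * (∑ m ∈ s, r n m) ^ 2 + 3 * ∑ m ∈ s, r n m ^ 2) * (1 - C (y n) * X) ^ 2) *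
      ∏ m ∈ s.erase n, (1 - C (y m) * X) ^ 3 with hW
  have hdeg1 : ∀ m ∈ s, ((1 - C (y m) * X : F[X]) ^ 3).natDegree = 3 := by
    intro m hm
    have : (1 - C (y m) * X : F[X]).natDegree = 1 := by
      rw [show (1 - C (y m) * X : F[X]) = C (-y m) * X + C 1 by simp; ring]
      exact natDegree_linear (neg_ne_zero.mpr (hy0 m hm))
    rw [natDegree_pow, this]
  have hne : ∀ m ∈ s, (1 - C (y m) * X : F[X]) ^ 3 ≠ 0 := by
    intro m hm h
    have := hdeg1 m hm
    rw [h] at this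
    simp at this
  have hdeg : (∏ m ∈ s, (1 - C (y m) * X : F[X]) ^ 3).natDegree = 3 * #s := by
    rw [natDegree_prod _ _ hne, Finset.sum_congr rfl hdeg1]
    simp [mul_comm]
  have hdvd : ∏ m ∈ s, (1 - C (y m) * X : F[X]) ^ 3 ∣ W - 2 := by
    apply Finset.prod_dvd_of_coprime
    · intro n hn m hm hnm
      exact (isCoprime_one_sub_C_mul_X (hy n hn m hm hnm)).pow
    · intro n hn
      rw [hW, ← Finset.add_sum_erase _ _ hn, add_sub_right_comm]
      apply dvd_add
      · have h1 := dvd_cube_prod_one_add_mul s (fun m => C (r n m)) (1 - C (y n) * X)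
        have h2 : ∏ m ∈ s, (1 + C (r n m) * (1 - C (y n) * X)) =
            C (∏ m ∈ s, (1 + r n m)) * ∏ m ∈ s.erase n, (1 - C (y m) * X) := by
          rw [map_prod, ← Finset.mul_prod_erase _ _ hn, ← Finset.mul_prod_erase _ (fun m =>
            C (1 + r n m)) hn, hr0 n hn, mul_assoc, ← Finset.prod_mul_distrib]
          congr 1
          · simp
          · refine Finset.prod_congr rfl fun m hm => ?_
            have h3 := hr n hn m (Finset.mem_of_mem_erase hm) (Finset.ne_of_mem_erase hm).symm
            have h4 := congrArg (C : F → F[X]) h3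
            simp only [map_mul, map_sub, map_add, map_one] at h4 ⊢
            linear_combination -X * h4
        rw [h2] at h1
        convert h1 using 1
        rw [Finset.prod_pow]
        simp only [map_mul, map_add, map_pow, map_sum, map_ofNat]
        ring
      · refine Finset.dvd_sum fun m hm => Dvd.dvd.mul_left (Finset.dvd_prod_of_mem
          (fun m => (1 - C (y m) * X : F[X]) ^ 3) ?_) _
        exact Finset.mem_erase.mpr ⟨(Finset.ne_of_mem_erase hm).symm, hn⟩
  have hlt : (W - 2).natDegree < (∏ m ∈ s, (1 - C (y m) * X : F[X]) ^ 3).natDegree := by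
    rw [hdeg]
    have hcard : 1 ≤ #s := hs.card_pos
    have hd : ∀ a : F, (1 - C a * X : F[X]).natDegree ≤ 1 := fun a => by compute_degree
    have hW' : W.natDegree ≤ 3 * #s - 1 := by
      refine natDegree_sum_le_of_forall_le _ _ fun n hn => ?_
      have e1 : (∏ m ∈ s.erase n, (1 - C (y m) * X : F[X]) ^ 3).natDegree = 3 * (#s - 1) := by
        rw [natDegree_prod _ _ fun m hm => hne m (Finset.mem_of_mem_erase hm),
          Finset.sum_congr rfl fun m hm => hdeg1 m (Finset.mem_of_mem_erase hm)]
        simp [mul_comm, Finset.card_erase_of_mem hn]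
      refine natDegree_mul_le.trans ?_
      rw [e1]
      have e2 : (C ((∏ m ∈ s, (1 + r n m)) ^ 3) * (2 - C (6 * ∑ m ∈ s, r n m) *
        (1 - C (y n) * X) + C (9 * (∑ m ∈ s, r n m) ^ 2 + 3 * ∑ m ∈ s, r n m ^ 2) *
        (1 - C (y n) * X) ^ 2)).natDegree ≤ 2 := by
        compute_degree
      omega
    have h2 : (2 : F[X]).natDegree = 0 := natDegree_ofNat 2
    have := natDegree_sub_le W 2
    omega
  exact sub_eq_zero.mp (Polynomial.eq_zero_of_dvd_of_natDegree_lt hdvd hlt)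

end PartialFractions

section CubeGen

open PowerSeries

variable {R : Type*} [CommRing R]

/-- The generating series `∏ 1 / (1 - x m T) ^ 3` in the variable `T`. -/
noncomputable def cubeGen (s : Finset ℕ) (x : ℕ → R) : R⟦X⟧ :=
  ∏ m ∈ s, (PowerSeries.mk fun i => x m ^ i) ^ 3

lemma one_sub_mul_mk_pow (a : R) : (1 - C a * X) * (PowerSeries.mk fun i => a ^ i) = 1 := by
  ext n
  rw [sub_mul, one_mul, mul_assoc, map_sub, coeff_C_mul, coeff_mk, coeff_one]
  cases n with
  | zero => simp
  | succ n => rw [coeff_succ_X_mul, coeff_mk, if_neg (by omega), pow_succ']; ring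

lemma coeff_mk_pow_pow (a : R) (d i : ℕ) :
    coeff i ((PowerSeries.mk fun i => a ^ i) ^ (d + 1)) = (d + i).choose d * a ^ i := by
  have h : (PowerSeries.mk fun i => a ^ i) = rescale a (PowerSeries.mk 1) := by
    ext n; simp [coeff_rescale]
  rw [h, ← map_pow, mk_one_pow_eq_mk_choose_add, coeff_rescale, coeff_mk, mul_comm]

lemma derivative_mk_pow (a : R) : derivative R (PowerSeries.mk fun i => a ^ i) =
    (PowerSeries.mk fun i => a ^ i) * PowerSeries.mk fun i => a ^ (i + 1) := by
  ext n
  rw [coeff_derivative, coeff_mk, coeff_mul]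
  simp only [coeff_mk, ← pow_add]
  rw [Finset.sum_congr rfl (g := fun _ => a ^ (n + 1)), Finset.sum_const,
    Finset.Nat.card_antidiagonal, nsmul_eq_mul, mul_comm, Nat.cast_add_one]
  intro p hp
  rw [← mem_antidiagonal.mp hp]
  ring

lemma derivative_cubeGen (s : Finset ℕ) (x : ℕ → R) : derivative R (cubeGen s x) =
    cubeGen s x * (3 * PowerSeries.mk fun i => ∑ m ∈ s, x m ^ (i + 1)) := by
  induction s using Finset.cons_induction with
  | empty =>
    have : (PowerSeries.mk fun _ => 0 : R⟦X⟧) = 0 := rfl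
    simp [cubeGen, this]
  | cons a s ha ih =>
    have e : (PowerSeries.mk fun i => ∑ m ∈ Finset.cons a s ha, x m ^ (i + 1)) =
        (PowerSeries.mk fun i => x a ^ (i + 1)) +
          PowerSeries.mk fun i => ∑ m ∈ s, x m ^ (i + 1) := by
      ext n; simp only [coeff_mk, map_add, Finset.sum_cons]
    rw [cubeGen] at ih ⊢
    rw [Finset.prod_cons, Derivation.leibniz, ih, Derivation.leibniz_pow, derivative_mk_pow, e]
    simp only [smul_eq_mul, nsmul_eq_mul]
    push_cast
    ring

lemma succ_mul_coeff_cubeGen (s : Finset ℕ) (x : ℕ → R) (n : ℕ) :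
    (n + 1) * coeff (n + 1) (cubeGen s x) =
      3 * ∑ p ∈ antidiagonal n, coeff p.1 (cubeGen s x) * ∑ m ∈ s, x m ^ (p.2 + 1) := by
  have h := congrArg (coeff n) (derivative_cubeGen s x)
  rw [coeff_derivative, mul_left_comm, ← map_ofNat (C (R := R)), coeff_C_mul, coeff_mul] at h
  simp only [coeff_mk] at h
  rw [← h, mul_comm]

lemma coeff_zero_cubeGen (s : Finset ℕ) (x : ℕ → R) : coeff 0 (cubeGen s x) = 1 := by
  simp [cubeGen, map_prod]

lemma map_cubeGen {S : Type*} [CommRing S] (f : R →+* S) (s : Finset ℕ) (x : ℕ → R) (i : ℕ) :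
    f (coeff i (cubeGen s x)) = coeff i (cubeGen s fun n => f (x n)) := by
  rw [← coeff_map, cubeGen, cubeGen, map_prod]
  congr 1
  refine Finset.prod_congr rfl fun m _ => ?_
  rw [map_pow]
  congr 1
  ext n
  simp

lemma two_mul_coeff_cubeGen_of_field {F : Type*} [Field F] (s : Finset ℕ) (hs : s.Nonempty)
    (y : ℕ → F) (hy0 : ∀ n ∈ s, y n ≠ 0) (hy : ∀ n ∈ s, ∀ m ∈ s, n ≠ m → y n ≠ y m)
    (r : ℕ → ℕ → F) (hr0 : ∀ n ∈ s, r n n = 0)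
    (hr : ∀ n ∈ s, ∀ m ∈ s, n ≠ m → r n m * (y n - y m) = y m) (i : ℕ) :
    2 * coeff i (cubeGen s y) = ∑ n ∈ s, (∏ m ∈ s, (1 + r n m)) ^ 3 * y n ^ i *
      ((i + 1) * (i + 2) - 6 * (i + 1) * ∑ m ∈ s, r n m +
        (9 * (∑ m ∈ s, r n m) ^ 2 + 3 * ∑ m ∈ s, r n m ^ 2)) := by
  have h := congrArg (fun f : Polynomial F => (f : F⟦X⟧) * cubeGen s y)
    (hermite_partial_fractions s hs y hy0 hy r hr0 hr)
  have e2 : ((2 : Polynomial F) : F⟦X⟧) = 2 := by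
    rw [← map_ofNat (Polynomial.C), Polynomial.coe_C, map_ofNat]
  have hsum : ∀ f : ℕ → Polynomial F, ((∑ n ∈ s, f n : Polynomial F) : F⟦X⟧) =
      ∑ n ∈ s, (f n : F⟦X⟧) := fun f => map_sum Polynomial.coeToPowerSeries.ringHom f s
  have hprod : ∀ (s : Finset ℕ) (f : ℕ → Polynomial F), ((∏ n ∈ s, f n : Polynomial F) : F⟦X⟧) =
      ∏ n ∈ s, (f n : F⟦X⟧) := fun s f => map_prod Polynomial.coeToPowerSeries.ringHom f s
  simp only [hsum, hprod, e2, Polynomial.coe_mul, Polynomial.coe_C, Polynomial.coe_X,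
    Polynomial.coe_add, Polynomial.coe_sub, Polynomial.coe_pow, Polynomial.coe_one] at h
  have h' := congrArg (coeff i) h
  rw [← map_ofNat (C (R := F)) 2, coeff_C_mul] at h'
  rw [← h', Finset.sum_mul, map_sum]
  refine Finset.sum_congr rfl fun n hn => ?_
  set v : F⟦X⟧ := PowerSeries.mk fun i => y n ^ i with hv
  have hv1 : (1 - C (y n) * X) * v = 1 := one_sub_mul_mk_pow (y n)
  have hG : (∏ m ∈ s.erase n, (1 - C (y m) * X) ^ 3) * cubeGen s y = v ^ 3 := by
    rw [cubeGen, ← Finset.mul_prod_erase _ _ hn, mul_left_comm, ← Finset.prod_mul_distrib,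
      Finset.prod_eq_one, mul_one]
    intro m _
    rw [← mul_pow, one_sub_mul_mk_pow, one_pow]
  set A := ∏ m ∈ s, (1 + r n m)
  set a := ∑ m ∈ s, r n m
  set b := ∑ m ∈ s, r n m ^ 2
  have e3 : C (A ^ 3) * (C 2 - C (6 * a) * (1 - C (y n) * X) +
      C (9 * a ^ 2 + 3 * b) * (1 - C (y n) * X) ^ 2) *
      (∏ m ∈ s.erase n, (1 - C (y m) * X) ^ 3) * cubeGen s y =
      C (A ^ 3) * (C 2 * v ^ (2 + 1) - C (6 * a) * v ^ (1 + 1) +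
        C (9 * a ^ 2 + 3 * b) * v ^ (0 + 1)) := by
    linear_combination C (A ^ 3) * (C 2 - C (6 * a) * (1 - C (y n) * X) +
      C (9 * a ^ 2 + 3 * b) * (1 - C (y n) * X) ^ 2) * hG - C (A ^ 3) * C (6 * a) * v ^ 2 * hv1 +
      C (A ^ 3) * C (9 * a ^ 2 + 3 * b) * v * ((1 - C (y n) * X) * v + 1) * hv1
  have e4 : (2 : F) * ((2 + i).choose 2 : F) = (i + 1) * (i + 2) := by
    have : 2 * (2 + i).choose 2 = (i + 1) * (i + 2) := by
      have h := Nat.add_one_mul_choose_eq (i + 1) 1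
      simp only [Nat.choose_one_right] at h
      rw [show 2 + i = i + 1 + 1 by omega, mul_comm 2, ← h]
      ring
    have h := congrArg (Nat.cast (R := F)) this
    push_cast at h
    exact h
  have e5 : ((1 + i).choose 1 : F) = i + 1 := by rw [Nat.choose_one_right]; push_cast; ring
  rw [e3, coeff_C_mul, map_add, map_sub, coeff_C_mul, coeff_C_mul, coeff_C_mul,
    coeff_mk_pow_pow, coeff_mk_pow_pow, coeff_mk_pow_pow, e5, Nat.choose_zero_right]
  push_cast
  linear_combination A ^ 3 * y n ^ i * e4

lemma two_mul_coeff_cubeGen [IsDomain R] (s : Finset ℕ) (hs : s.Nonempty)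
    (y : ℕ → R) (hy0 : ∀ n ∈ s, y n ≠ 0) (hy : ∀ n ∈ s, ∀ m ∈ s, n ≠ m → y n ≠ y m)
    (r : ℕ → ℕ → R) (hr0 : ∀ n ∈ s, r n n = 0)
    (hr : ∀ n ∈ s, ∀ m ∈ s, n ≠ m → r n m * (y n - y m) = y m) (i : ℕ) :
    2 * coeff i (cubeGen s y) = ∑ n ∈ s, (∏ m ∈ s, (1 + r n m)) ^ 3 * y n ^ i *
      ((i + 1) * (i + 2) - 6 * (i + 1) * ∑ m ∈ s, r n m +
        (9 * (∑ m ∈ s, r n m) ^ 2 + 3 * ∑ m ∈ s, r n m ^ 2)) := by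
  have hinj := IsFractionRing.injective R (FractionRing R)
  apply hinj
  rw [map_mul, map_cubeGen, map_ofNat, two_mul_coeff_cubeGen_of_field s hs _
    (fun n hn => (map_ne_zero_iff _ hinj).mpr (hy0 n hn))
    (fun n hn m hm h => hinj.ne (hy n hn m hm h))
    (fun n m => algebraMap R (FractionRing R) (r n m))
    (fun n hn => by rw [hr0 n hn, map_zero])
    (fun n hn m hm h => by rw [← map_sub, ← map_mul, hr n hn m hm h])]
  simp only [map_sum, map_mul, map_prod, map_add, map_sub, map_pow, map_natCast, map_one,
    map_ofNat]

end CubeGen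

section Recurrence

open PowerSeries

variable {k : Type*} [Field k]

/-- The summands `(-1) ^ n X ^ (n (3 n + 1) / 2) (1 + X ^ n) / (1 - X ^ n) ^ 2` in the rank
part of the `spt` generating function. -/
noncomputable def pentTerm (k : Type*) [Field k] (n : ℕ) : k⟦X⟧ :=
  (-1) ^ n * X ^ (3 * n.choose 2 + n) * (1 + X ^ n) * lam k n

/-- The moments `∑ pentTerm n * lam n ^ j` over `1 ≤ n ≤ N`. -/
noncomputable def moment (k : Type*) [Field k] (N j : ℕ) : k⟦X⟧ :=
  ∑ n ∈ Icc 1 N, pentTerm k n * lam k n ^ j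

/-- The coefficient of `T ^ i` in `∏ 1 / (1 - lam n * T) ^ 3` over `1 ≤ n ≤ N`. -/
noncomputable def cubeCoeff (k : Type*) [Field k] (N i : ℕ) : k⟦X⟧ :=
  coeff i (cubeGen (Icc 1 N) (lam k))

lemma two_mul_cubeCoeff (h2 : (2 : k) ≠ 0) {N : ℕ} (hN : N ≠ 0) (i : ℕ) :
    2 * cubeCoeff k N i = ∑ n ∈ Icc 1 N, alpha k N n ^ 3 * lam k n ^ i *
      ((i + 1) * (i + 2) - 6 * (i + 1) * ∑ m ∈ Icc 1 N, rho k n m +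
        (9 * (∑ m ∈ Icc 1 N, rho k n m) ^ 2 + 3 * ∑ m ∈ Icc 1 N, rho k n m ^ 2)) := by
  have h0 : ∀ n ∈ Icc 1 N, n ≠ 0 := fun n hn => by rw [Finset.mem_Icc] at hn; omega
  exact two_mul_coeff_cubeGen (Icc 1 N) ⟨1, by rw [Finset.mem_Icc]; omega⟩ (lam k)
    (fun n hn => lam_ne_zero (h0 n hn))
    (fun n hn m hm h => lam_ne_lam h2 (h0 n hn) (h0 m hm) h) (rho k)
    (fun n _ => rho_self n) (fun n hn m hm h => rho_mul_sub h2 (h0 n hn) (h0 m hm) h) i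

lemma two_mul_pent_exponent (n : ℕ) :
    2 * (3 * (n + 1).choose 2 + (n + 1)) + (n + 1) = 3 * (n + 1) ^ 2 := by
  have : 2 * (n + 1).choose 2 = (n + 1) * n := by
    rw [Nat.choose_two_right, Nat.mul_div_cancel' (Nat.even_mul_pred_self _).two_dvd,
      Nat.add_sub_cancel]
  linear_combination 3 * this

lemma two_mul_coth_mul_theta_pentTerm {n : ℕ} (hn : n ≠ 0) :
    2 * coth k n * theta (pentTerm k n) = pentTerm k n *
      (3 * (n : k⟦X⟧) ^ 2 * coth k n + 2 * n * coth k n ^ 2 - n) := by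
  have h1 := one_sub_mul_geom (k := k) hn
  have hs : theta ((-1 : k⟦X⟧) ^ n) = 0 := by
    rcases neg_one_pow_eq_or (k⟦X⟧) n with h | h <;> rw [h]
    · exact Derivation.map_one_eq_zero _
    · rw [map_neg, Derivation.map_one_eq_zero, neg_zero]
  have he : 2 * ((3 * n.choose 2 + n : ℕ) : k⟦X⟧) = 3 * (n : k⟦X⟧) ^ 2 - n := by
    obtain ⟨m, rfl⟩ := Nat.exists_eq_succ_of_ne_zero hn
    have h := two_mul_pent_exponent m
    simp only [Nat.succ_eq_add_one]
    have h' := congrArg (Nat.cast (R := k⟦X⟧)) h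
    push_cast at h' ⊢
    linear_combination h'
  rw [pentTerm, theta_mul, theta_mul, theta_mul, theta_lam hn, hs, theta_X_pow, map_add,
    Derivation.map_one_eq_zero, theta_X_pow]
  have hc : 2 * coth k n * X ^ n = (1 + X ^ n) * (coth k n - 1) := by
    rw [coth]; linear_combination -(1 + X ^ n) * h1
  linear_combination (-1) ^ n * X ^ (3 * n.choose 2 + n) * (1 + X ^ n) * lam k n * coth k n * he +
    (-1) ^ n * X ^ (3 * n.choose 2 + n) * lam k n * n * hc

lemma pentTerm_mul_coth_sq (l : ℕ) : pentTerm k (l + 1) * coth k (l + 1) ^ 2 =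
    -((-1) ^ l * X ^ (l + 1).choose 2 * (1 + X ^ (l + 1))) ^ 3 * lam k (l + 1) ^ 2 := by
  have hs : ((-1 : k⟦X⟧) ^ l) ^ 3 = (-1) ^ l := by
    rcases neg_one_pow_eq_or (k⟦X⟧) l with h | h <;> rw [h] <;> norm_num
  rw [pentTerm, mul_pow, mul_pow, hs, coth, lam, pow_succ, pow_add, pow_mul']
  ring

lemma isUnit_four_mul_coth (h2 : (2 : k) ≠ 0) {n : ℕ} (hn : n ≠ 0) :
    IsUnit (4 * coth k n) := by
  rw [PowerSeries.isUnit_iff_constantCoeff, show 4 * coth k n = 2 * (2 * coth k n) by ring,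
    map_mul, map_ofNat]
  exact (mul_ne_zero h2 (constantCoeff_two_mul_coth h2 hn)).isUnit

lemma X_pow_dvd_pentTerm (n : ℕ) : X ^ n ∣ pentTerm k n :=
  Dvd.dvd.mul_left (X_pow_dvd_lam n) _

lemma dvd_recurrence_term (h2 : (2 : k) ≠ 0) (l K j : ℕ) :
    X ^ (l + 1 + K + 1) ∣
      2 * ((j : k⟦X⟧) + 1) * (2 * (j : k⟦X⟧) + 3) * (pentTerm k (l + 1) * lam k (l + 1) ^ (j + 1)) +
      (6 * psum k (l + 1 + K) 1 + (j : k⟦X⟧) * ((j : k⟦X⟧) + 1)) *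
        (pentTerm k (l + 1) * lam k (l + 1) ^ j) +
      6 * theta (pentTerm k (l + 1) * lam k (l + 1) ^ j) +
      alpha k (l + 1 + K) (l + 1) ^ 3 * lam k (l + 1) ^ (j + 2) *
      ((((j + 2 : ℕ) : k⟦X⟧) + 1) * (((j + 2 : ℕ) : k⟦X⟧) + 2) -
        6 * (((j + 2 : ℕ) : k⟦X⟧) + 1) * ∑ m ∈ Icc 1 (l + 1 + K), rho k (l + 1) m +
        (9 * (∑ m ∈ Icc 1 (l + 1 + K), rho k (l + 1) m) ^ 2 +
          3 * ∑ m ∈ Icc 1 (l + 1 + K), rho k (l + 1) m ^ 2)) := by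
  have hn : l + 1 ≠ 0 := by omega
  obtain ⟨c, hc⟩ := alpha_congr h2 l K
  obtain ⟨c1, hc1⟩ := sum_cothDiff (k := k) (l + 1) K hn
  obtain ⟨c2, hc2⟩ := sum_cothDiff_sq (k := k) (l + 1) K hn
  have hp := two_mul_coth_mul_theta_pentTerm (k := k) hn
  have hg := pentTerm_mul_coth_sq (k := k) l
  have hx : theta (lam k (l + 1) ^ j) =
      j * ((l + 1 : ℕ) : k⟦X⟧) * coth k (l + 1) * lam k (l + 1) ^ j := by
    cases j with
    | zero => simp
    | succ j => rw [theta_pow, theta_lam hn]; push_cast; ring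
  have e1 : 2 * coth k (l + 1) * ∑ m ∈ Icc 1 (l + 1 + K), rho k (l + 1) m =
      ∑ m ∈ Icc 1 (l + 1 + K), cothDiff k (l + 1) m := by
    rw [Finset.mul_sum]
    exact Finset.sum_congr rfl fun m _ => two_mul_coth_mul_rho h2 hn m
  have e2 : 4 * coth k (l + 1) ^ 2 * ∑ m ∈ Icc 1 (l + 1 + K), rho k (l + 1) m ^ 2 =
      ∑ m ∈ Icc 1 (l + 1 + K), cothDiff k (l + 1) m ^ 2 := by
    rw [Finset.mul_sum]
    refine Finset.sum_congr rfl fun m _ => ?_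
    rw [← two_mul_coth_mul_rho h2 hn m]
    ring
  have f1 := coth_sq (k := k) hn
  have f2 := coth_sq (k := k) (n := 2 * (l + 1)) (by omega)
  have f3 := coth_mul_coth (k := k) hn hn
  rw [← two_mul (l + 1)] at f3
  obtain ⟨b, hb⟩ := X_pow_dvd_pentTerm (k := k) (l + 1)
  obtain ⟨d, hd⟩ := X_pow_dvd_lam (k := k) (l + 1)
  rw [theta_mul, hx, ← (isUnit_four_mul_coth h2 hn).dvd_mul_left]
  rw [show l + 1 + K + 1 = (l + 1) + (K + 1) by omega, pow_add X (l + 1) (K + 1)]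
  set n : k⟦X⟧ := ((l + 1 : ℕ) : k⟦X⟧)
  set T := coth k (l + 1)
  set B := coth k (2 * (l + 1))
  set x := lam k (l + 1)
  set x2 := lam k (2 * (l + 1))
  set r1 := ∑ m ∈ Icc 1 (l + 1 + K), rho k (l + 1) m
  set r2 := ∑ m ∈ Icc 1 (l + 1 + K), rho k (l + 1) m ^ 2
  set R1 := ∑ m ∈ Icc 1 (l + 1 + K), cothDiff k (l + 1) m
  set R2 := ∑ m ∈ Icc 1 (l + 1 + K), cothDiff k (l + 1) m ^ 2
  set p := psum k (l + 1 + K) 1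
  set A := alpha k (l + 1 + K) (l + 1)
  set a := pentTerm k (l + 1)
  set g : k⟦X⟧ := (-1) ^ l * X ^ (l + 1).choose 2 * (1 + X ^ (l + 1))
  set J : k⟦X⟧ := (j : k⟦X⟧)
  push_cast
  set Y := (X : k⟦X⟧) ^ (l + 1)
  set Z := (X : k⟦X⟧) ^ (K + 1)
  have key : T * (8 * (J + 1) * (2 * J + 3) * x + 4 * (6 * p + J * (J + 1)) + 24 * J * n * T) +
      12 * (3 * n ^ 2 * T + 2 * n * T ^ 2 - n) - T * (4 * (J + 3) * (J + 4) * T ^ 2 -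
        12 * (J + 3) * T * R1 + 9 * R1 ^ 2 + 3 * R2) =
      Z * (T * (12 * (J + 3) * T * c1 - 9 * c1 * (R1 + (T + B - 2 * n)) + 6 * B * c1 -
        3 * c2)) := by
    linear_combination (T * (12 * (J + 3) * T - 9 * (R1 + (T + B - 2 * n)) + 6 * B)) * hc1 -
      3 * T * hc2 - T * (2 * (J + 1) * (2 * J + 3) + 3) * f1 - 3 * T * f2 -
      (6 * (J + 3) * T - 6 * (T - 2 * n)) * f3
  refine ⟨b * x ^ j * (T * (12 * (J + 3) * T * c1 - 9 * c1 * (2 * T * r1 + (T + B - 2 * n)) +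
    6 * B * c1 - 3 * c2)) + d * x ^ (j + 1) * (4 * T) * (c * (A ^ 2 + A * g + g ^ 2)) *
    ((J + 2 + 1) * (J + 2 + 2) - 6 * (J + 2 + 1) * r1 + (9 * r1 ^ 2 + 3 * r2)), ?_⟩
  rw [← e1, ← e2] at key
  linear_combination a * x ^ j * key + 12 * x ^ j * hp +
    x ^ j * Z * (T * (12 * (J + 3) * T * c1 - 9 * c1 * (2 * T * r1 + (T + B - 2 * n)) +
    6 * B * c1 - 3 * c2)) * hb + 4 * T * x ^ j * x ^ 2 * (A ^ 2 + A * g + g ^ 2) *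
    ((J + 2 + 1) * (J + 2 + 2) - 6 * (J + 2 + 1) * r1 + (9 * r1 ^ 2 + 3 * r2)) * hc +
    4 * T * x ^ j * ((J + 2 + 1) * (J + 2 + 2) - 6 * (J + 2 + 1) * r1 + (9 * r1 ^ 2 + 3 * r2)) * hg
    + Z * x ^ (j + 1) * (4 * T) * (c * (A ^ 2 + A * g + g ^ 2)) *
    ((J + 2 + 1) * (J + 2 + 2) - 6 * (J + 2 + 1) * r1 + (9 * r1 ^ 2 + 3 * r2)) * hd

lemma dvd_moment_recurrence (h2 : (2 : k) ≠ 0) {N : ℕ} (hN : N ≠ 0) (j : ℕ) :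
    X ^ (N + 1) ∣ 2 * ((j : k⟦X⟧) + 1) * (2 * (j : k⟦X⟧) + 3) * moment k N (j + 1) +
      (6 * psum k N 1 + (j : k⟦X⟧) * ((j : k⟦X⟧) + 1)) * moment k N j + 6 * theta (moment k N j) +
      2 * cubeCoeff k N (j + 2) := by
  rw [two_mul_cubeCoeff h2 hN, moment, moment, map_sum, Finset.mul_sum, Finset.mul_sum,
    Finset.mul_sum, ← Finset.sum_add_distrib, ← Finset.sum_add_distrib,
    ← Finset.sum_add_distrib]
  refine Finset.dvd_sum fun n hn => ?_
  rw [Finset.mem_Icc] at hn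
  obtain ⟨l, rfl⟩ := Nat.exists_eq_succ_of_ne_zero (by omega : n ≠ 0)
  obtain ⟨K, rfl⟩ := Nat.exists_eq_add_of_le hn.2
  exact dvd_recurrence_term h2 l K j

end Recurrence

section PowerSums

open PowerSeries

variable {k : Type*} [Field k]

lemma pow_mul_rho_add_swap (h2 : (2 : k) ≠ 0) {n m : ℕ} (hn : n ≠ 0) (hm : m ≠ 0) (j : ℕ) :
    lam k n ^ (j + 1) * rho k n m + lam k m ^ (j + 1) * rho k m n =
      ∑ a ∈ range j, lam k n ^ (a + 1) * lam k m ^ (j - a) -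
        if n = m then (j : k⟦X⟧) * lam k n ^ (j + 1) else 0 := by
  split_ifs with h
  · subst h
    have : ∀ a ∈ range j, lam k n ^ (a + 1) * lam k n ^ (j - a) = lam k n ^ (j + 1) := by
      intro a ha
      rw [Finset.mem_range] at ha
      rw [← pow_add]
      congr 1
      omega
    rw [rho_self, Finset.sum_congr rfl this]
    simp
  · have h1 := rho_mul_sub h2 hn hm h
    have h3 := geom_sum₂_mul (lam k n) (lam k m) (j + 1)
    rw [Finset.sum_range_succ'] at h3
    have : ∑ a ∈ range j, lam k n ^ (a + 1) * lam k m ^ (j - a) =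
        lam k m * ∑ a ∈ range j, lam k n ^ (a + 1) * lam k m ^ (j + 1 - 1 - (a + 1)) := by
      rw [Finset.mul_sum]
      refine Finset.sum_congr rfl fun a ha => ?_
      rw [Finset.mem_range] at ha
      rw [show j - a = j + 1 - 1 - (a + 1) + 1 by omega, pow_succ]
      ring
    rw [rho_swap h2 hn hm h, this, sub_zero]
    simp only [pow_zero, one_mul, Nat.add_sub_cancel, Nat.sub_zero] at h3 ⊢
    linear_combination (∑ a ∈ range j, lam k n ^ (a + 1) * lam k m ^ (j - (a + 1)) +
      lam k m ^ j) * h1 - rho k n m * h3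

lemma two_mul_sum_pow_mul_rho (h2 : (2 : k) ≠ 0) (N j : ℕ) :
    2 * ∑ n ∈ Icc 1 N, lam k n ^ (j + 1) * ∑ m ∈ Icc 1 N, rho k n m =
      ∑ a ∈ range j, psum k N (a + 1) * psum k N (j - a) - (j : k⟦X⟧) * psum k N (j + 1) := by
  simp only [Finset.mul_sum]
  have h0 : ∀ n ∈ Icc 1 N, n ≠ 0 := fun n hn => by rw [Finset.mem_Icc] at hn; omega
  have e : ∑ n ∈ Icc 1 N, ∑ m ∈ Icc 1 N, (2 * (lam k n ^ (j + 1) * rho k n m)) =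
      ∑ n ∈ Icc 1 N, ∑ m ∈ Icc 1 N,
        (lam k n ^ (j + 1) * rho k n m + lam k m ^ (j + 1) * rho k m n) := by
    simp only [two_mul, Finset.sum_add_distrib]
    congr 1
    rw [Finset.sum_comm]
  rw [e, Finset.sum_congr rfl fun n hn => Finset.sum_congr rfl fun m hm =>
    pow_mul_rho_add_swap h2 (h0 n hn) (h0 m hm) j]
  simp only [Finset.sum_sub_distrib, Finset.sum_ite_eq]
  congr 1
  · simp only [psum, Finset.sum_mul_sum]
    rw [Finset.sum_comm (s := range j)]
    exact Finset.sum_congr rfl fun n _ => Finset.sum_comm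
  · rw [psum, Finset.mul_sum]
    refine Finset.sum_congr rfl fun n hn => if_pos hn

lemma dvd_theta_lam_pow (h2 : (2 : k) ≠ 0) {n : ℕ} (hn : n ≠ 0) (K j : ℕ) :
    X ^ (n + K + 1) ∣ theta (lam k n ^ (j + 1)) - ((j : k⟦X⟧) + 1) *
      (lam k n ^ (j + 1) + 3 * lam k n ^ (j + 2) - (1 + 4 * lam k n) *
        (lam k n ^ (j + 1) * ∑ m ∈ Icc 1 (n + K), rho k n m)) := by
  obtain ⟨c, hc⟩ := sum_cothDiff (k := k) n K hn
  obtain ⟨d, hd⟩ := X_pow_dvd_lam (k := k) n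
  have e1 : 2 * coth k n * ∑ m ∈ Icc 1 (n + K), rho k n m =
      ∑ m ∈ Icc 1 (n + K), cothDiff k n m := by
    rw [Finset.mul_sum]
    exact Finset.sum_congr rfl fun m _ => two_mul_coth_mul_rho h2 hn m
  rw [← e1] at hc
  have f1 := coth_sq (k := k) hn
  have f3 := coth_mul_coth (k := k) hn hn
  rw [← two_mul n] at f3
  rw [theta_pow, theta_lam hn, ← (isUnit_four_mul_coth h2 hn).dvd_mul_left,
    show n + K + 1 = n + (K + 1) by omega, pow_add X]
  set r := ∑ m ∈ Icc 1 (n + K), rho k n m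
  set x := lam k n
  set T := coth k n
  refine ⟨2 * T ^ 2 * c * ((j : k⟦X⟧) + 1) * x ^ j * d, ?_⟩
  linear_combination ((j : k⟦X⟧) + 1) * T * x ^ (j + 1) * (2 * T * hc - f3) +
    2 * T ^ 2 * c * ((j : k⟦X⟧) + 1) * x ^ j * X ^ (K + 1) * hd +
    ((j : k⟦X⟧) + 1) * T * x ^ (j + 1) * (3 - 4 * r) * f1

lemma dvd_theta_psum (h2 : (2 : k) ≠ 0) (N j : ℕ) :
    X ^ (N + 1) ∣ 2 * theta (psum k N (j + 1)) - ((j : k⟦X⟧) + 1) *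
      (2 * psum k N (j + 1) + 6 * psum k N (j + 2) -
        (∑ a ∈ range j, psum k N (a + 1) * psum k N (j - a) - (j : k⟦X⟧) * psum k N (j + 1)) -
        4 * (∑ a ∈ range (j + 1), psum k N (a + 1) * psum k N (j + 1 - a) -
          ((j : k⟦X⟧) + 1) * psum k N (j + 2))) := by
  rw [← two_mul_sum_pow_mul_rho h2]
  have h := two_mul_sum_pow_mul_rho h2 N (j + 1)
  push_cast at h
  rw [← h]
  have : X ^ (N + 1) ∣ ∑ n ∈ Icc 1 N, (theta (lam k n ^ (j + 1)) - ((j : k⟦X⟧) + 1) *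
      (lam k n ^ (j + 1) + 3 * lam k n ^ (j + 2) - (1 + 4 * lam k n) *
        (lam k n ^ (j + 1) * ∑ m ∈ Icc 1 N, rho k n m))) := by
    refine Finset.dvd_sum fun n hn => ?_
    rw [Finset.mem_Icc] at hn
    obtain ⟨K, rfl⟩ := Nat.exists_eq_add_of_le hn.2
    exact dvd_theta_lam_pow h2 (by omega) K j
  convert dvd_mul_of_dvd_right this 2 using 1
  have e : ∀ n, (1 + 4 * lam k n) * (lam k n ^ (j + 1) * ∑ m ∈ Icc 1 N, rho k n m) =
      lam k n ^ (j + 1) * ∑ m ∈ Icc 1 N, rho k n m +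
      4 * (lam k n ^ (j + 2) * ∑ m ∈ Icc 1 N, rho k n m) := fun n => by ring
  simp only [e, psum, Finset.sum_sub_distrib, Finset.sum_add_distrib, ← Finset.mul_sum, map_sum]
  ring

end PowerSums

section Lambert

open PowerSeries

variable {k : Type*} [Field k]

lemma theta_qPoch (N : ℕ) :
    theta (qPoch k N) = -(qPoch k N * ∑ n ∈ Icc 1 N, (n : k⟦X⟧) * (X ^ n * geom k n)) := by
  induction N with
  | zero => simp [qPoch_zero]
  | succ N ih =>
    have h := one_sub_mul_geom (k := k) (n := N + 1) (by omega)
    rw [qPoch_succ, theta_mul, ih, Finset.sum_Icc_succ_top (by omega), map_sub,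
      Derivation.map_one_eq_zero, theta_X_pow]
    linear_combination ((N + 1 : ℕ) : k⟦X⟧) * X ^ (N + 1) * qPoch k N * h

lemma dvd_X_pow_mul_geom_sub {m : ℕ} (hm : m ≠ 0) (N : ℕ) :
    (X : k⟦X⟧) ^ (N + 1) ∣ X ^ m * geom k m - ∑ c ∈ Icc 1 N, X ^ (m * c) := by
  have h : (1 - X ^ m) * ∑ c ∈ Icc 1 N, (X : k⟦X⟧) ^ (m * c) = X ^ m - X ^ (m * (N + 1)) := by
    induction N with
    | zero => simp
    | succ N ih => rw [Finset.sum_Icc_succ_top (by omega), mul_add, ih]; ring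
  have hg := one_sub_mul_geom (k := k) hm
  refine (pow_dvd_pow X (Nat.le_mul_of_pos_left (N + 1) (Nat.pos_of_ne_zero hm))).trans
    ⟨geom k m, ?_⟩
  linear_combination -geom k m * h + (∑ c ∈ Icc 1 N, (X : k⟦X⟧) ^ (m * c)) * hg

lemma dvd_lam_sub {c : ℕ} (hc : c ≠ 0) (N : ℕ) :
    (X : k⟦X⟧) ^ (N + 1) ∣ lam k c - ∑ m ∈ Icc 1 N, (m : k⟦X⟧) * X ^ (m * c) := by
  have h : (1 - (X : k⟦X⟧) ^ c) ^ 2 * ∑ m ∈ Icc 1 N, (m : k⟦X⟧) * X ^ (m * c) =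
      X ^ c - X ^ (c * (N + 1)) * ((N : k⟦X⟧) + 1 - (N : k⟦X⟧) * X ^ c) := by
    induction N with
    | zero => simp
    | succ N ih => rw [Finset.sum_Icc_succ_top (by omega), mul_add, ih]; push_cast; ring
  have hg := one_sub_mul_geom (k := k) hc
  refine (pow_dvd_pow X (Nat.le_mul_of_pos_left (N + 1) (Nat.pos_of_ne_zero hc))).trans
    ⟨geom k c ^ 2 * ((N : k⟦X⟧) + 1 - (N : k⟦X⟧) * X ^ c), ?_⟩
  rw [lam]
  linear_combination -geom k c ^ 2 * h + (∑ m ∈ Icc 1 N, (m : k⟦X⟧) * X ^ (m * c)) *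
    ((1 - X ^ c) * geom k c + 1) * hg

lemma dvd_theta_qPoch_add (N : ℕ) :
    (X : k⟦X⟧) ^ (N + 1) ∣ theta (qPoch k N) + psum k N 1 * qPoch k N := by
  have h0 : ∀ n ∈ Icc 1 N, n ≠ 0 := fun n hn => by rw [Finset.mem_Icc] at hn; omega
  have h1 : (X : k⟦X⟧) ^ (N + 1) ∣ ∑ m ∈ Icc 1 N, (m : k⟦X⟧) *
      (X ^ m * geom k m - ∑ c ∈ Icc 1 N, X ^ (m * c)) :=
    Finset.dvd_sum fun m hm => dvd_mul_of_dvd_right (dvd_X_pow_mul_geom_sub (h0 m hm) N) _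
  have h2 : (X : k⟦X⟧) ^ (N + 1) ∣ ∑ c ∈ Icc 1 N,
      (lam k c - ∑ m ∈ Icc 1 N, (m : k⟦X⟧) * X ^ (m * c)) :=
    Finset.dvd_sum fun c hc => dvd_lam_sub (h0 c hc) N
  have h3 := dvd_mul_of_dvd_right (dvd_sub h2 h1) (qPoch k N)
  convert h3 using 1
  simp only [mul_sub, Finset.sum_sub_distrib, Finset.mul_sum (Icc 1 N) (fun c => X ^ (_ * c))]
  rw [Finset.sum_comm, theta_qPoch, psum]
  simp only [pow_one]
  ring

end Lambert

section Bailey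

open PowerSeries

variable {k : Type*} [Field k]

/-- The finite product `∏ 1 / (1 - X ^ m)` over `1 ≤ m ≤ n`. -/
noncomputable def invPoch (k : Type*) [Field k] (n : ℕ) : k⟦X⟧ := ∏ m ∈ Icc 1 n, geom k m

/-- The pentagonal terms `(-1) ^ r (X ^ (r (3 r - 1) / 2) + X ^ (r (3 r + 1) / 2))`. -/
noncomputable def pent (k : Type*) [Field k] (r : ℕ) : k⟦X⟧ :=
  (-1) ^ r * X ^ (3 * r.choose 2 + r) * (1 + X ^ r)

lemma invPoch_zero : invPoch k 0 = 1 := by simp [invPoch]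

lemma invPoch_succ (n : ℕ) : invPoch k (n + 1) = invPoch k n * geom k (n + 1) :=
  Finset.prod_Icc_succ_top (by omega) _

lemma invPoch_eq (n : ℕ) : invPoch k n = invPoch k (n + 1) * (1 - X ^ (n + 1)) := by
  rw [invPoch_succ]
  linear_combination -invPoch k n * one_sub_mul_geom (k := k) (n := n + 1) (by omega)

lemma qPoch_mul_invPoch (n : ℕ) : qPoch k n * invPoch k n = 1 := by
  rw [qPoch, invPoch, ← Finset.prod_mul_distrib]
  exact Finset.prod_eq_one fun m hm =>
    one_sub_mul_geom (by rw [Finset.mem_Icc] at hm; omega)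

lemma X_pow_dvd_pent (r : ℕ) : X ^ r ∣ pent k r := by
  rw [pent, pow_add X]
  exact ⟨(-1) ^ r * X ^ (3 * r.choose 2) * (1 + X ^ r), by ring⟩

lemma three_mul_choose_succ (r : ℕ) : 3 * (r + 1).choose 2 + (r + 1) =
    3 * r.choose 2 + r + (3 * r + 1) := by
  rw [Nat.choose_succ_succ r 1, Nat.choose_one_right]; ring

lemma sum_pent_partial (N R : ℕ) (h : R ≤ N) :
    ∑ r ∈ Icc 1 R, ((1 - X ^ (N + 1)) * (pent k r * (invPoch k (N + 1 - r) * invPoch k (N + 1 + r)))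
      - pent k r * (invPoch k (N - r) * invPoch k (N + r))) =
      (-1) ^ R * X ^ (3 * R.choose 2 + R) * invPoch k (N + 1 - R) * invPoch k (N + 1 + R) *
        X ^ (N + 1 + 2 * R) * (1 - X ^ (N + 1 - R)) -
        invPoch k (N + 1) ^ 2 * X ^ (N + 1) * (1 - X ^ (N + 1)) := by
  induction R with
  | zero => simp; ring
  | succ R ih =>
    rw [Finset.sum_Icc_succ_top (by omega), ih (by omega)]
    obtain ⟨K, rfl⟩ := Nat.exists_eq_add_of_le h
    have e1 := invPoch_eq (k := k) K
    have e2 := invPoch_eq (k := k) (K + 1)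
    have e3 := invPoch_eq (k := k) (R + 1 + K + (R + 1))
    rw [pent, three_mul_choose_succ, show R + 1 + K + 1 - R = K + 1 + 1 by omega,
      show R + 1 + K + 1 - (R + 1) = K + 1 by omega, show R + 1 + K - (R + 1) = K by omega,
      show R + 1 + K + 1 + R = R + 1 + K + (R + 1) by omega,
      show R + 1 + K + 1 + (R + 1) = R + 1 + K + (R + 1) + 1 by omega]
    rw [e3, e1, e2]
    ring

lemma sum_pent_mul (N : ℕ) :
    invPoch k N ^ 2 + ∑ r ∈ Icc 1 N, pent k r * (invPoch k (N - r) * invPoch k (N + r)) =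
      invPoch k N := by
  induction N with
  | zero => simp [invPoch_zero]
  | succ N ih =>
    have h := sum_pent_partial (k := k) N N le_rfl
    have e1 := invPoch_eq (k := k) N
    have e2 := invPoch_eq (k := k) (N + 1 + N)
    have e3 := one_sub_mul_geom (k := k) (n := 1) (by omega)
    rw [Finset.sum_sub_distrib, ← Finset.mul_sum, show N + 1 - N = 0 + 1 by omega,
      invPoch_succ 0, invPoch_zero, zero_add] at h
    apply mul_left_cancel₀ (one_sub_X_pow_ne_zero (k := k) (n := N + 1) (by omega))
    rw [Finset.sum_Icc_succ_top (by omega), pent, three_mul_choose_succ, Nat.sub_self,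
      invPoch_zero, show N + 1 + (N + 1) = N + 1 + N + 1 by omega]
    rw [e1] at ih
    rw [e2] at h
    linear_combination ih + h + (-1) ^ N * X ^ (3 * N.choose 2 + N) *
      (invPoch k (N + 1 + N + 1) * (1 - X ^ (N + 1 + N + 1))) * X ^ (N + 1 + 2 * N) * e3

lemma sum_X_pow_mul_qPoch (N : ℕ) :
    ∑ n ∈ Icc 1 N, X ^ n * qPoch k (n - 1) * geom k n = psum k N 1 + qPoch k N ^ 2 *
      ∑ r ∈ Icc 1 N, pentTerm k r * (invPoch k (N - r) * invPoch k (N + r)) := by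
  induction N with
  | zero => simp [psum]
  | succ N ih =>
    have h := sum_pent_mul (k := k) (N + 1)
    have hq := qPoch_mul_invPoch (k := k) N
    have e : ∀ r ∈ Icc 1 N,
        qPoch k (N + 1) ^ 2 * (pentTerm k r * (invPoch k (N + 1 - r) * invPoch k (N + 1 + r))) =
        qPoch k N ^ 2 * (pentTerm k r * (invPoch k (N - r) * invPoch k (N + r))) +
        X ^ (N + 1) * qPoch k N ^ 2 *
          (pent k r * (invPoch k (N + 1 - r) * invPoch k (N + 1 + r))) := by
      intro r hr
      rw [Finset.mem_Icc] at hr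
      obtain ⟨K, rfl⟩ := Nat.exists_eq_add_of_le hr.2
      have hl := one_sub_sq_mul_lam (k := k) (n := r) (by omega)
      have e1 := invPoch_eq (k := k) K
      have e2 := invPoch_eq (k := k) (r + K + r)
      rw [show pentTerm k r = pent k r * lam k r from rfl,
        show r + K + 1 - r = K + 1 by omega, show r + K - r = K by omega,
        show r + K + 1 + r = r + K + r + 1 by omega, e1, e2, qPoch_succ]
      linear_combination qPoch k (r + K) ^ 2 * pent k r * invPoch k (K + 1) *
        invPoch k (r + K + r + 1) * X ^ (K + 1) * hl
    have hl := one_sub_sq_mul_lam (k := k) (n := N + 1) (by omega)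
    rw [Finset.sum_Icc_succ_top (by omega), ih, Finset.mul_sum (Icc 1 (N + 1)),
      Finset.sum_Icc_succ_top (by omega), Finset.sum_congr rfl e, Finset.sum_add_distrib,
      ← Finset.mul_sum, ← Finset.mul_sum, psum, psum, Finset.sum_Icc_succ_top (by omega),
      show pentTerm k (N + 1) = pent k (N + 1) * lam k (N + 1) from rfl, qPoch_succ,
      Nat.add_sub_cancel]
    rw [Finset.sum_Icc_succ_top (by omega), invPoch_succ N] at h
    rw [lam] at hl ⊢
    linear_combination -qPoch k N ^ 2 * pent k (N + 1) *
      (invPoch k (N + 1 - (N + 1)) * invPoch k (N + 1 + (N + 1))) * hl -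
      X ^ (N + 1) * qPoch k N ^ 2 * h + X ^ (N + 1) * geom k (N + 1) *
      (geom k (N + 1) * (qPoch k N * invPoch k N + 1) - qPoch k N) * hq

lemma dvd_pent_mul_sub {N r : ℕ} (h : r ≤ N) :
    X ^ (N + 1) ∣ pent k r * (qPoch k N ^ 2 * (invPoch k (N - r) * invPoch k (N + r)) - 1) := by
  obtain ⟨K, rfl⟩ := Nat.exists_eq_add_of_le h
  obtain ⟨a, ha⟩ := dvd_qPoch_add_sub (k := k) K r
  obtain ⟨b, hb⟩ := dvd_qPoch_add_sub (k := k) K (2 * r)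
  obtain ⟨c, hc⟩ := X_pow_dvd_pent (k := k) r
  rw [show r + K - r = K by omega, show r + K + r = K + 2 * r by omega, add_assoc r K 1,
    pow_add X, add_comm r K]
  have e1 := qPoch_mul_invPoch (k := k) K
  have e2 := qPoch_mul_invPoch (k := k) (K + 2 * r)
  refine ⟨c * (a * (qPoch k (K + r) + qPoch k K) - qPoch k K * b) *
    (invPoch k K * invPoch k (K + 2 * r)), ?_⟩
  linear_combination pent k r * (invPoch k K * invPoch k (K + 2 * r)) *
    ((qPoch k (K + r) + qPoch k K) * ha - qPoch k K * hb) +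
    pent k r * (qPoch k (K + 2 * r) * invPoch k (K + 2 * r) * e1 + e2) +
    X ^ (K + 1) * (a * (qPoch k (K + r) + qPoch k K) - qPoch k K * b) *
    (invPoch k K * invPoch k (K + 2 * r)) * hc

lemma dvd_qPoch_sub (N : ℕ) : X ^ (N + 1) ∣ qPoch k N - (1 + ∑ r ∈ Icc 1 N, pent k r) := by
  have h : X ^ (N + 1) ∣ ∑ r ∈ Icc 1 N,
      pent k r * (qPoch k N ^ 2 * (invPoch k (N - r) * invPoch k (N + r)) - 1) :=
    Finset.dvd_sum fun r hr => dvd_pent_mul_sub (Finset.mem_Icc.mp hr).2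
  have e : ∀ r, pent k r * (qPoch k N ^ 2 * (invPoch k (N - r) * invPoch k (N + r)) - 1) =
      qPoch k N ^ 2 * (pent k r * (invPoch k (N - r) * invPoch k (N + r))) - pent k r :=
    fun r => by ring
  simp only [e, Finset.sum_sub_distrib, ← Finset.mul_sum] at h
  convert h using 1
  linear_combination (qPoch k N * invPoch k N - qPoch k N + 1) * qPoch_mul_invPoch (k := k) N -
    qPoch k N ^ 2 * sum_pent_mul (k := k) N

lemma dvd_sum_X_pow_mul_qPoch_sub (N : ℕ) :
    X ^ (N + 1) ∣ ∑ n ∈ Icc 1 N, X ^ n * qPoch k (n - 1) * geom k n -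
      (psum k N 1 + moment k N 0) := by
  have h : X ^ (N + 1) ∣ ∑ r ∈ Icc 1 N, lam k r *
      (pent k r * (qPoch k N ^ 2 * (invPoch k (N - r) * invPoch k (N + r)) - 1)) :=
    Finset.dvd_sum fun r hr =>
      dvd_mul_of_dvd_right (dvd_pent_mul_sub (Finset.mem_Icc.mp hr).2) _
  have e : ∀ r, lam k r *
      (pent k r * (qPoch k N ^ 2 * (invPoch k (N - r) * invPoch k (N + r)) - 1)) =
      qPoch k N ^ 2 * (pentTerm k r * (invPoch k (N - r) * invPoch k (N + r))) - pentTerm k r :=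
    fun r => by rw [show pentTerm k r = pent k r * lam k r from rfl]; ring
  simp only [e, Finset.sum_sub_distrib, ← Finset.mul_sum] at h
  rw [sum_X_pow_mul_qPoch, moment]
  simp only [pow_zero, mul_one]
  convert h using 1
  ring

end Bailey

section GeneratingFunction

open PowerSeries

variable {k : Type*} [Field k]

/-- Weights selecting the partitions with parts in `[j, N]`, with weight `u c` when the part `j`
appears `c ≠ 0` times. -/
noncomputable def sptWeight (k : Type*) [Field k] (N j : ℕ) (u : ℕ → k) (i c : ℕ) : k :=
  if i = j then u c else if j < i ∧ i ≤ N then 1 else 0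

open scoped Classical in
lemma sptWeight_prod_sub {n N : ℕ} (hn : n ≤ N) (j : ℕ) (π : n.Partition) :
    π.parts.toFinsupp.prod (sptWeight k N j Nat.cast) -
      π.parts.toFinsupp.prod (sptWeight k N j 0) =
      if ∀ b ∈ π.parts, j ≤ b then (π.parts.count j : k) else 0 := by
  simp only [Finsupp.prod, Multiset.toFinsupp_support, Multiset.toFinsupp_apply]
  by_cases hj : j ∈ π.parts
  · have hj' := Multiset.mem_toFinset.mpr hj
    rw [Finset.prod_eq_zero (f := fun i => sptWeight k N j 0 i _) hj' (by simp [sptWeight]),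
      sub_zero]
    split_ifs with h
    · rw [← Finset.mul_prod_erase _ _ hj', Finset.prod_eq_one, mul_one, sptWeight, if_pos rfl]
      intro i hi
      rw [Finset.mem_erase, Multiset.mem_toFinset] at hi
      have h1 := h i hi.2
      have h2 := π.le_of_mem_parts hi.2
      rw [sptWeight, if_neg hi.1, if_pos (by omega)]
    · push Not at h
      obtain ⟨b, hb, hbj⟩ := h
      refine Finset.prod_eq_zero (Multiset.mem_toFinset.mpr hb) ?_
      rw [sptWeight, if_neg (by omega), if_neg (by omega)]
  · rw [Multiset.count_eq_zero.mpr hj, Nat.cast_zero, ite_self, sub_eq_zero]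
    refine Finset.prod_congr rfl fun i hi => ?_
    have : i ≠ j := by rintro rfl; exact hj (Multiset.mem_toFinset.mp hi)
    rw [sptWeight, sptWeight, if_neg this, if_neg this]

lemma natCast_spt {n N : ℕ} (hn : n ≤ N) :
    (spt n : k) = coeff n (∑ j ∈ Icc 1 N, (Nat.Partition.genFun (sptWeight k N j Nat.cast) -
      Nat.Partition.genFun (sptWeight k N j 0))) := by
  classical
  simp only [map_sum, map_sub, Nat.Partition.coeff_genFun, ← Finset.sum_sub_distrib,
    sptWeight_prod_sub hn]
  rw [Finset.sum_comm, spt, Nat.cast_sum]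
  refine Finset.sum_congr rfl fun π _ => ?_
  rw [← Multiset.sum_count_eq_card (s := Icc 1 N), Nat.cast_sum]
  · refine Finset.sum_congr rfl fun j _ => ?_
    rw [Multiset.count_filter]
    split_ifs <;> simp
  · intro a ha
    have ha := (Multiset.mem_filter.mp ha).1
    have h1 := π.parts_pos ha
    have h2 := π.le_of_mem_parts ha
    rw [Finset.mem_Icc]
    omega

open scoped PowerSeries.WithPiTopology

lemma tsum_X_pow [TopologicalSpace k] [DiscreteTopology k] {i : ℕ} (hi : i ≠ 0) :
    1 + ∑' c, (X : k⟦X⟧) ^ (i * (c + 1)) = geom k i := by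
  have h := Nat.Partition.summable_genFun_term' (fun _ _ => (1 : k)) hi
  simp only [one_smul] at h
  have e := h.tsum_eq_zero_add
  have e1 : ∀ c, (X : k⟦X⟧) ^ (i * (c + 1 + 1)) = X ^ i * X ^ (i * (c + 1)) := fun c => by ring
  simp only [e1] at e
  rw [h.tsum_mul_left] at e
  have hg := one_sub_mul_geom (k := k) hi
  simp only [zero_add, mul_one] at e
  linear_combination geom k i * e - (∑' c, (X : k⟦X⟧) ^ (i * (c + 1)) + 1) * hg

lemma tsum_natCast_smul_X_pow [TopologicalSpace k] [DiscreteTopology k] {i : ℕ} (hi : i ≠ 0) :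
    ∑' c, ((c + 1 : ℕ) : k) • (X : k⟦X⟧) ^ (i * (c + 1)) = lam k i := by
  have h0 := Nat.Partition.summable_genFun_term' (fun _ _ => (1 : k)) hi
  simp only [one_smul] at h0
  have h := Nat.Partition.summable_genFun_term' (fun _ c => (c : k)) hi
  have e := h.tsum_eq_zero_add
  have e1 : ∀ c, ((c + 1 + 1 : ℕ) : k) • (X : k⟦X⟧) ^ (i * (c + 1 + 1)) =
      X ^ i * (((c + 1 : ℕ) : k) • X ^ (i * (c + 1)) + X ^ (i * (c + 1))) := fun c => by
    rw [show i * (c + 1 + 1) = i + i * (c + 1) by ring, pow_add X i, Nat.cast_succ (c + 1),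
      add_smul, one_smul, mul_add (X ^ i), mul_smul_comm]
  simp only [e1] at e
  rw [(h.add h0).tsum_mul_left, h.tsum_add h0] at e
  have hg := one_sub_mul_geom (k := k) hi
  have hs := tsum_X_pow (k := k) hi
  simp only [zero_add, mul_one, Nat.cast_one, one_smul] at e
  rw [lam]
  linear_combination geom k i * e + geom k i * X ^ i * hs -
    (∑' c, ((c + 1 : ℕ) : k) • (X : k⟦X⟧) ^ (i * (c + 1))) * hg

lemma genFun_sptWeight {N j : ℕ} (hj : j ≠ 0) (hjN : j ≤ N) (u : ℕ → k) (v : k⟦X⟧)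
    (hv : ∀ [TopologicalSpace k] [DiscreteTopology k],
      ∑' c, u (c + 1) • (X : k⟦X⟧) ^ (j * (c + 1)) = v) :
    Nat.Partition.genFun (sptWeight k N j u) = (1 + v) * ∏ i ∈ Ioc j N, geom k i := by
  let _ : TopologicalSpace k := ⊥
  have : DiscreteTopology k := ⟨rfl⟩
  have h := Nat.Partition.hasProd_genFun (sptWeight k N j u)
  have h' := hasProd_prod_of_ne_finset_one (s := range N)
    (f := fun i ↦ 1 + ∑' c, sptWeight k N j u (i + 1) (c + 1) • (X : k⟦X⟧) ^ ((i + 1) * (c + 1)))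
    (L := SummationFilter.unconditional ℕ) (fun i hi => by
      rw [Finset.mem_range] at hi
      simp [sptWeight, show i + 1 ≠ j by omega, show ¬ i + 1 ≤ N by omega])
  have hr : ∀ F : ℕ → k⟦X⟧, ∏ i ∈ range N, F (i + 1) = ∏ i ∈ Icc 1 N, F i := fun F => by
    rw [Finset.range_eq_Ico, Finset.prod_Ico_add' F 0 N 1]
    rfl
  rw [h.unique h', hr fun i => 1 + ∑' c, sptWeight k N j u i (c + 1) • (X : k⟦X⟧) ^ (i * (c + 1)),
    ← Finset.prod_subset (Finset.Icc_subset_Icc_left (by omega : 1 ≤ j)),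
    ← Finset.mul_prod_Ioc_eq_prod_Icc hjN]
  · congr 1
    · simp only [sptWeight, if_true, hv]
    · refine Finset.prod_congr rfl fun i hi => ?_
      rw [Finset.mem_Ioc] at hi
      rw [← tsum_X_pow (by omega)]
      simp [sptWeight, show i ≠ j by omega, hi]
  · intro i hi hi'
    rw [Finset.mem_Icc] at hi hi'
    simp [sptWeight, show i ≠ j by omega, show ¬ j < i by omega]

lemma prod_Ioc_geom {N j : ℕ} (hjN : j ≤ N) :
    ∏ i ∈ Ioc j N, geom k i = invPoch k N * qPoch k j := by
  induction N, hjN using Nat.le_induction with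
  | base => rw [mul_comm, qPoch_mul_invPoch]; simp
  | succ N hN ih => rw [Finset.prod_Ioc_succ_top (by omega), ih, invPoch_succ]; ring

lemma natCast_spt_eq_coeff {n N : ℕ} (hn : n ≤ N) : (spt n : k) =
    coeff n (invPoch k N * ∑ j ∈ Icc 1 N, X ^ j * qPoch k (j - 1) * geom k j) := by
  rw [natCast_spt hn, Finset.mul_sum]
  congr 1
  refine Finset.sum_congr rfl fun j hj => ?_
  rw [Finset.mem_Icc] at hj
  have hj0 : j ≠ 0 := by omega
  rw [genFun_sptWeight hj0 hj.2 _ _ (tsum_natCast_smul_X_pow hj0),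
    genFun_sptWeight hj0 hj.2 _ 0 (by simp), prod_Ioc_geom hj.2]
  obtain ⟨i, rfl⟩ := Nat.exists_eq_succ_of_ne_zero hj0
  simp only [Nat.succ_eq_add_one] at *
  rw [qPoch_succ, lam, Nat.add_sub_cancel]
  linear_combination invPoch k N * qPoch k i * X ^ (i + 1) * geom k (i + 1) *
    one_sub_mul_geom (k := k) (n := i + 1) (by omega)

end GeneratingFunction

section Congruences

open PowerSeries

variable {k : Type*} [Field k]

lemma theta_ofNat (n : ℕ) [n.AtLeastTwo] : theta (ofNat(n) : k⟦X⟧) = 0 := by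
  rw [← Nat.cast_ofNat]; exact theta_natCast n

lemma dvd_of_dvd_two_mul (h2 : (2 : k) ≠ 0) {M : ℕ} {f : k⟦X⟧} (h : X ^ M ∣ 2 * f) :
    X ^ M ∣ f := by
  have : (2 : k⟦X⟧) * C (2⁻¹ : k) = 1 := by
    rw [← map_ofNat (C (R := k)) 2, ← map_mul, mul_inv_cancel₀ h2, map_one]
  obtain ⟨g, hg⟩ := h
  exact ⟨C (2⁻¹ : k) * g, by linear_combination C (2⁻¹ : k) * hg - f * this⟩

lemma dvd_theta_psum_one (h2 : (2 : k) ≠ 0) (N : ℕ) : X ^ (N + 1) ∣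
    theta (psum k N 1) - (psum k N 1 + 5 * psum k N 2 - 2 * psum k N 1 ^ 2) := by
  refine dvd_of_dvd_two_mul h2 ?_
  convert dvd_theta_psum h2 N 0 using 1
  simp
  ring

lemma dvd_theta_psum_two (h2 : (2 : k) ≠ 0) (N : ℕ) : X ^ (N + 1) ∣
    theta (psum k N 2) - (3 * psum k N 2 + 14 * psum k N 3 - psum k N 1 ^ 2 -
      8 * psum k N 1 * psum k N 2) := by
  refine dvd_of_dvd_two_mul h2 ?_
  convert dvd_theta_psum h2 N 1 using 1
  simp [Finset.sum_range_succ]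
  ring

lemma dvd_theta_psum_three (h2 : (2 : k) ≠ 0) (N : ℕ) : X ^ (N + 1) ∣
    theta (psum k N 3) - (6 * psum k N 3 + 27 * psum k N 4 - 3 * psum k N 1 * psum k N 2 -
      12 * psum k N 1 * psum k N 3 - 6 * psum k N 2 ^ 2) := by
  refine dvd_of_dvd_two_mul h2 ?_
  convert dvd_theta_psum h2 N 2 using 1
  simp [Finset.sum_range_succ]
  ring

lemma cubeCoeff_one (N : ℕ) : cubeCoeff k N 1 = 3 * psum k N 1 := by
  have h := succ_mul_coeff_cubeGen (Icc 1 N) (lam k) 0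
  simpa [coeff_zero_cubeGen, cubeCoeff, psum] using h

lemma two_mul_cubeCoeff_two (N : ℕ) :
    2 * cubeCoeff k N 2 = 9 * psum k N 1 ^ 2 + 3 * psum k N 2 := by
  have h := succ_mul_coeff_cubeGen (Icc 1 N) (lam k) 1
  have h1 := cubeCoeff_one (k := k) N
  simp only [Finset.Nat.sum_antidiagonal_eq_sum_range_succ_mk, Finset.sum_range_succ,
    Finset.sum_range_zero, coeff_zero_cubeGen, Nat.reduceAdd, Nat.reduceSub] at h
  simp only [cubeCoeff, psum] at h1 ⊢
  push_cast at h
  linear_combination h + 3 * (∑ m ∈ Icc 1 N, lam k m ^ 1) * h1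

lemma six_mul_cubeCoeff_three (N : ℕ) : 6 * cubeCoeff k N 3 =
    27 * psum k N 1 ^ 3 + 27 * psum k N 1 * psum k N 2 + 6 * psum k N 3 := by
  have h := succ_mul_coeff_cubeGen (Icc 1 N) (lam k) 2
  have h1 := cubeCoeff_one (k := k) N
  have h2 := two_mul_cubeCoeff_two (k := k) N
  simp only [Finset.Nat.sum_antidiagonal_eq_sum_range_succ_mk, Finset.sum_range_succ,
    Finset.sum_range_zero, coeff_zero_cubeGen, Nat.reduceAdd, Nat.reduceSub] at h
  simp only [cubeCoeff, psum] at h1 h2 ⊢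
  push_cast at h
  linear_combination 2 * h + 3 * (∑ m ∈ Icc 1 N, lam k m ^ 1) * h2 +
    6 * (∑ m ∈ Icc 1 N, lam k m ^ 2) * h1

lemma twentyfour_mul_cubeCoeff_four (N : ℕ) : 24 * cubeCoeff k N 4 =
    81 * psum k N 1 ^ 4 + 162 * psum k N 1 ^ 2 * psum k N 2 + 72 * psum k N 1 * psum k N 3 +
      27 * psum k N 2 ^ 2 + 18 * psum k N 4 := by
  have h := succ_mul_coeff_cubeGen (Icc 1 N) (lam k) 3
  have h1 := cubeCoeff_one (k := k) N
  have h2 := two_mul_cubeCoeff_two (k := k) N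
  have h3 := six_mul_cubeCoeff_three (k := k) N
  simp only [Finset.Nat.sum_antidiagonal_eq_sum_range_succ_mk, Finset.sum_range_succ,
    Finset.sum_range_zero, coeff_zero_cubeGen, Nat.reduceAdd, Nat.reduceSub] at h
  simp only [cubeCoeff, psum] at h1 h2 h3 ⊢
  push_cast at h
  linear_combination 6 * h + 3 * (∑ m ∈ Icc 1 N, lam k m ^ 1) * h3 +
    9 * (∑ m ∈ Icc 1 N, lam k m ^ 2) * h2 + 18 * (∑ m ∈ Icc 1 N, lam k m ^ 3) * h1

lemma dvd_theta_invPoch_sub (N : ℕ) :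
    X ^ (N + 1) ∣ theta (invPoch k N) - psum k N 1 * invPoch k N := by
  have h := qPoch_mul_invPoch (k := k) N
  have h' := congrArg theta h
  rw [theta_mul, Derivation.map_one_eq_zero] at h'
  obtain ⟨w, hw⟩ := dvd_theta_qPoch_add (k := k) N
  exact ⟨-invPoch k N ^ 2 * w, by
    linear_combination invPoch k N * h' - invPoch k N ^ 2 * hw -
      (theta (invPoch k N) - psum k N 1 * invPoch k N) * h⟩

lemma dvd_moment_recurrence_zero (h2 : (2 : k) ≠ 0) {N : ℕ} (hN : N ≠ 0) : X ^ (N + 1) ∣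
    6 * moment k N 1 + 6 * psum k N 1 * moment k N 0 + 6 * theta (moment k N 0) +
      2 * cubeCoeff k N 2 := by
  convert dvd_moment_recurrence h2 hN 0 using 1
  push_cast
  ring_nf

lemma dvd_moment_recurrence_one (h2 : (2 : k) ≠ 0) {N : ℕ} (hN : N ≠ 0) : X ^ (N + 1) ∣
    20 * moment k N 2 + (6 * psum k N 1 + 2) * moment k N 1 + 6 * theta (moment k N 1) +
      2 * cubeCoeff k N 3 := by
  convert dvd_moment_recurrence h2 hN 1 using 1
  push_cast
  ring_nf

lemma dvd_moment_recurrence_two (h2 : (2 : k) ≠ 0) {N : ℕ} (hN : N ≠ 0) : X ^ (N + 1) ∣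
    42 * moment k N 3 + (6 * psum k N 1 + 6) * moment k N 2 + 6 * theta (moment k N 2) +
      2 * cubeCoeff k N 4 := by
  convert dvd_moment_recurrence h2 hN 2 using 1
  push_cast
  ring_nf

lemma natCast_spt_eq_zero {n : ℕ} {c W : k⟦X⟧} {a : k} (hc : c = C a) (hn : (n : k) = a)
    (h : X ^ (n + 1) ∣ invPoch k n * (psum k n 1 + moment k n 0) - (theta W - c * W)) :
    (spt n : k) = 0 := by
  have h0 : X ^ (n + 1) ∣ invPoch k n * (∑ j ∈ Icc 1 n, X ^ j * qPoch k (j - 1) * geom k j) -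
      (theta W - c * W) := by
    have := dvd_add (dvd_mul_of_dvd_right (dvd_sum_X_pow_mul_qPoch_sub (k := k) n)
      (invPoch k n)) h
    convert this using 1
    ring
  have h1 := X_pow_dvd_iff.mp h0 n (Nat.lt_succ_self n)
  rw [map_sub, map_sub, coeff_theta, hc, coeff_C_mul, hn, sub_self, sub_zero] at h1
  rw [natCast_spt_eq_coeff le_rfl, h1]

lemma natCast_spt_five_eq_zero (h2 : (2 : k) ≠ 0) (h5 : (5 : k) = 0) (n : ℕ) :
    (spt (5 * n + 4) : k) = 0 := by
  have h : (5 : k⟦X⟧) = 0 := by rw [← map_ofNat (C (R := k)) 5, h5, map_zero]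
  have hcast : ((5 * n + 4 : ℕ) : k) = 4 := by push_cast; linear_combination n * h5
  have hN : 5 * n + 4 ≠ 0 := by omega
  generalize 5 * n + 4 = N at *
  refine natCast_spt_eq_zero (c := 4) (W := invPoch k N * (2 * psum k N 2 +
    3 * psum k N 1 + 3 * (psum k N 1 * psum k N 1) + moment k N 0 + 4 * moment k N 1))
    (map_ofNat (C (R := k)) 4).symm hcast ?_
  simp only [theta_mul, map_add, theta_ofNat]
  have g2 := two_mul_cubeCoeff_two (k := k) N
  have g3 := six_mul_cubeCoeff_three (k := k) N
  obtain ⟨wP, hP⟩ := dvd_theta_invPoch_sub (k := k) N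
  obtain ⟨w1, d1⟩ := dvd_theta_psum_one h2 N
  obtain ⟨w2, d2⟩ := dvd_theta_psum_two h2 N
  obtain ⟨u0, r0⟩ := dvd_moment_recurrence_zero h2 hN
  obtain ⟨u1, r1⟩ := dvd_moment_recurrence_one h2 hN
  generalize invPoch k N = P at *
  generalize psum k N 1 = p1 at *
  generalize psum k N 2 = p2 at *
  generalize psum k N 3 = p3 at *
  generalize moment k N 0 = V0 at *
  generalize moment k N 1 = V1 at *
  generalize moment k N 2 = V2 at *
  generalize cubeCoeff k N 2 = H2 at *
  generalize cubeCoeff k N 3 = H3 at *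
  generalize theta P = dP at *
  generalize theta p1 = dp1 at *
  generalize theta p2 = dp2 at *
  generalize theta V0 = e0 at *
  generalize theta V1 = e1 at *
  exact ⟨(2 * p1 ^ 2 + 2 * p1 - 2 * p2 - V0 + V1) * wP + 2 * (2 * P * p1 + P) * w1 -
    2 * P * w2 - P * u0 + P * u1, by
    linear_combination (2 * p1 ^ 2 + 2 * p1 - 2 * p2 - V0 + V1) * hP +
      2 * (2 * P * p1 + P) * d1 - 2 * P * d2 - P * r0 + P * r1 + P * g2 - 2 * P * g3 +
      (-12 * P * p1 ^ 3 + 5 * P * p1 ^ 2 - 4 * P * p1 * p2 + P * p1 * V0 - P * p1 * V1 -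
      2 * P * p1 * dp1 + 3 * P * p1 + 3 * P * p2 - 8 * P * p3 + P * V0 + 4 * P * V1 -
      4 * P * V2 - P * dp1 + P * e0 - 2 * P * e1 + 2 * P * H3 - p1 ^ 2 * dP - p1 * dP -
      V1 * dP) * h⟩

lemma seven_dvd_of_two_mul_add {m r : ℕ} (h : 2 * m + r = 3 * r ^ 2 ∨ 2 * m = 3 * r ^ 2 + r) :
    7 ∣ m ^ 4 + 6 * m ^ 3 + 3 * m ^ 2 + 4 * m := by
  rw [← ZMod.natCast_eq_zero_iff]
  have key : ∀ m r : ZMod 7, 2 * m + r = 3 * r ^ 2 ∨ 2 * m = 3 * r ^ 2 + r →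
      m ^ 4 + 6 * m ^ 3 + 3 * m ^ 2 + 4 * m = 0 := by decide
  have := key m r (by exact_mod_cast h.imp (congrArg Nat.cast) (congrArg Nat.cast))
  exact_mod_cast this

lemma theta_relation_X_pow (h7 : (7 : k⟦X⟧) = 0) {m r : ℕ}
    (h : 2 * m + r = 3 * r ^ 2 ∨ 2 * m = 3 * r ^ 2 + r) :
    theta (theta (theta (theta (X ^ m : k⟦X⟧)))) - theta (theta (theta (X ^ m : k⟦X⟧))) +
      3 * theta (theta (X ^ m : k⟦X⟧)) - 3 * theta (X ^ m : k⟦X⟧) = 0 := by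
  obtain ⟨d, hd⟩ := seven_dvd_of_two_mul_add h
  have hd' := congrArg (Nat.cast : ℕ → k⟦X⟧) hd
  push_cast at hd'
  simp only [theta_X_pow, theta_mul, theta_natCast, mul_zero, add_zero]
  linear_combination X ^ m * hd' +
    (X : k⟦X⟧) ^ m * (d - (m : k⟦X⟧) ^ 3 - (m : k⟦X⟧)) * h7

lemma theta_relation_pent (h7 : (7 : k⟦X⟧) = 0) (r : ℕ) :
    theta (theta (theta (theta (pent k (r + 1))))) - theta (theta (theta (pent k (r + 1)))) +
      3 * theta (theta (pent k (r + 1))) - 3 * theta (pent k (r + 1)) = 0 := by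
  have h := two_mul_pent_exponent r
  have h1 := theta_relation_X_pow h7 (Or.inl h)
  have h2 := theta_relation_X_pow h7 (r := r + 1)
    (m := 3 * (r + 1).choose 2 + (r + 1) + (r + 1)) (Or.inr (by omega))
  rw [pent, mul_assoc, mul_add, mul_one, ← pow_add]
  rcases neg_one_pow_eq_or k⟦X⟧ (r + 1) with e | e <;> rw [e]
  · simp only [one_mul, map_add]
    linear_combination h1 + h2
  · simp only [neg_mul, one_mul, map_add, map_neg]
    linear_combination -h1 - h2

lemma dvd_theta_sub_mul {M : ℕ} {f g g' p q : k⟦X⟧} (hf : X ^ M ∣ f - g * q)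
    (hq : X ^ M ∣ theta q + p * q) (hg : X ^ M ∣ theta g - g') :
    X ^ M ∣ theta f - (g' - p * g) * q := by
  have := dvd_add (X_pow_dvd_theta hf)
    (dvd_add (dvd_mul_of_dvd_right hq g) (dvd_mul_of_dvd_right hg q))
  rw [map_sub, theta_mul] at this
  convert this using 1
  ring

lemma dvd_psum_sub_sq_sub (h2 : (2 : k) ≠ 0) (h7 : (7 : k) = 0) (N : ℕ) :
    X ^ (N + 1) ∣ (psum k N 1 - psum k N 2) ^ 2 - psum k N 2 := by
  have h : (7 : k⟦X⟧) = 0 := by rw [← map_ofNat (C (R := k)) 7, h7, map_zero]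
  have hs : X ^ (N + 1) ∣ theta (theta (theta (theta (qPoch k N)))) -
      theta (theta (theta (qPoch k N))) + 3 * theta (theta (qPoch k N)) -
      3 * theta (qPoch k N) := by
    have t0 := dvd_qPoch_sub (k := k) N
    have t1 := X_pow_dvd_theta t0
    have t2 := X_pow_dvd_theta t1
    have t3 := X_pow_dvd_theta t2
    have t4 := X_pow_dvd_theta t3
    have := dvd_sub (dvd_add (dvd_sub t4 t3) (dvd_mul_of_dvd_right t2 3))
      (dvd_mul_of_dvd_right t1 3)
    have e : ∑ r ∈ Icc 1 N, (theta (theta (theta (theta (pent k r)))) -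
        theta (theta (theta (pent k r))) + 3 * theta (theta (pent k r)) -
        3 * theta (pent k r)) = 0 := by
      refine Finset.sum_eq_zero fun r hr => ?_
      rw [Finset.mem_Icc] at hr
      obtain ⟨l, rfl⟩ := Nat.exists_eq_succ_of_ne_zero (by omega : r ≠ 0)
      exact theta_relation_pent h l
    rw [Finset.sum_sub_distrib, Finset.sum_add_distrib, Finset.sum_sub_distrib,
      ← Finset.mul_sum, ← Finset.mul_sum] at e
    simp only [map_sub, map_add, map_sum, Derivation.map_one_eq_zero, map_zero] at this
    convert this using 1
    linear_combination e
  have hq := dvd_theta_qPoch_add (k := k) N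
  obtain ⟨w1, d1⟩ := dvd_theta_psum_one h2 N
  obtain ⟨w2, d2⟩ := dvd_theta_psum_two h2 N
  obtain ⟨w3, d3⟩ := dvd_theta_psum_three h2 N
  have hu := qPoch_mul_invPoch (k := k) N
  generalize invPoch k N = P at *
  generalize qPoch k N = q at *
  generalize psum k N 1 = p1 at *
  generalize psum k N 2 = p2 at *
  generalize psum k N 3 = p3 at *
  generalize psum k N 4 = p4 at *
  have t1 : X ^ (N + 1) ∣ theta q - (-p1) * q := by convert hq using 1; ring
  have t2 := dvd_theta_sub_mul t1 hq (g' := -(p1 + 5 * p2 - 2 * p1 ^ 2)) ⟨-w1, by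
    rw [map_neg]; linear_combination -d1⟩
  have t3 := dvd_theta_sub_mul (f := theta (theta q)) (g := 3 * (p1 * p1) - p1 - 5 * p2)
    (by convert t2 using 1; ring) hq
    (g' := (6 * p1 - 1) * (p1 + 5 * p2 - 2 * p1 ^ 2) -
      5 * (3 * p2 + 14 * p3 - p1 ^ 2 - 8 * p1 * p2)) ⟨(6 * p1 - 1) * w1 - 5 * w2, by
    simp only [map_sub, theta_mul, theta_ofNat]
    linear_combination (6 * p1 - 1) * d1 - 5 * d2⟩
  have t4 := dvd_theta_sub_mul (f := theta (theta (theta q)))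
    (g := -15 * (p1 * p1 * p1) + 14 * (p1 * p1) + 75 * (p1 * p2) - p1 - 20 * p2 - 70 * p3)
    (by convert t3 using 1; ring) hq
    (g' := (-45 * p1 ^ 2 + 28 * p1 + 75 * p2 - 1) * (p1 + 5 * p2 - 2 * p1 ^ 2) +
      (75 * p1 - 20) * (3 * p2 + 14 * p3 - p1 ^ 2 - 8 * p1 * p2) -
      70 * (6 * p3 + 27 * p4 - 3 * p1 * p2 - 12 * p1 * p3 - 6 * p2 ^ 2))
    ⟨(-45 * p1 ^ 2 + 28 * p1 + 75 * p2 - 1) * w1 + (75 * p1 - 20) * w2 - 70 * w3, by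
    simp only [map_sub, map_add, map_neg, neg_mul, theta_mul, theta_ofNat]
    linear_combination (-45 * p1 ^ 2 + 28 * p1 + 75 * p2 - 1) * d1 + (75 * p1 - 20) * d2 -
      70 * d3⟩
  have key := dvd_mul_of_dvd_right (dvd_sub hs (dvd_sub (dvd_add (dvd_sub t4 t3)
    (dvd_mul_of_dvd_right t2 3)) (dvd_mul_of_dvd_right t1 3))) (2 * P)
  convert key using 1
  linear_combination -2 * (105 * p1 ^ 4 - 175 * p1 ^ 3 - 1050 * p1 ^ 2 * p2 + 46 * p1 ^ 2 +
      755 * p1 * p2 + 1960 * p1 * p3 + 795 * p2 ^ 2 - 60 * p2 - 630 * p3 - 1890 * p4) * hu +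
    (-30 * p1 ^ 4 + 50 * p1 ^ 3 + 300 * p1 ^ 2 * p2 - 13 * p1 ^ 2 - 216 * p1 * p2 -
      560 * p1 * p3 - 227 * p2 ^ 2 + 17 * p2 + 180 * p3 + 540 * p4) * h

lemma natCast_spt_seven_eq_zero (h2 : (2 : k) ≠ 0) (h7 : (7 : k) = 0) (n : ℕ) :
    (spt (7 * n + 5) : k) = 0 := by
  have h : (7 : k⟦X⟧) = 0 := by rw [← map_ofNat (C (R := k)) 7, h7, map_zero]
  have hcast : ((7 * n + 5 : ℕ) : k) = 5 := by push_cast; linear_combination n * h7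
  have hN : 7 * n + 5 ≠ 0 := by omega
  generalize 7 * n + 5 = N at *
  refine natCast_spt_eq_zero (c := 5) (W := invPoch k N * (5 * psum k N 3 + 5 * psum k N 1 +
    2 * (psum k N 1 * psum k N 2) + 4 * (psum k N 1 * psum k N 1) +
    psum k N 1 * psum k N 1 * psum k N 1 + 4 * moment k N 0 + moment k N 1 + moment k N 2))
    (map_ofNat (C (R := k)) 5).symm hcast ?_
  simp only [theta_mul, map_add, theta_ofNat]
  have g2 := two_mul_cubeCoeff_two (k := k) N
  have g3 := six_mul_cubeCoeff_three (k := k) N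
  have g4 := twentyfour_mul_cubeCoeff_four (k := k) N
  obtain ⟨wP, hP⟩ := dvd_theta_invPoch_sub (k := k) N
  obtain ⟨w1, d1⟩ := dvd_theta_psum_one h2 N
  obtain ⟨w2, d2⟩ := dvd_theta_psum_two h2 N
  obtain ⟨w3, d3⟩ := dvd_theta_psum_three h2 N
  obtain ⟨u0, r0⟩ := dvd_moment_recurrence_zero h2 hN
  obtain ⟨u1, r1⟩ := dvd_moment_recurrence_one h2 hN
  obtain ⟨u2, r2⟩ := dvd_moment_recurrence_two h2 hN
  obtain ⟨v, hv⟩ := dvd_psum_sub_sq_sub h2 h7 N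
  generalize invPoch k N = P at *
  generalize psum k N 1 = p1 at *
  generalize psum k N 2 = p2 at *
  generalize psum k N 3 = p3 at *
  generalize psum k N 4 = p4 at *
  generalize moment k N 0 = V0 at *
  generalize moment k N 1 = V1 at *
  generalize moment k N 2 = V2 at *
  generalize moment k N 3 = V3 at *
  generalize cubeCoeff k N 2 = H2 at *
  generalize cubeCoeff k N 3 = H3 at *
  generalize cubeCoeff k N 4 = H4 at *
  generalize theta P = dP at *
  generalize theta p1 = dp1 at *
  generalize theta p2 = dp2 at *
  generalize theta p3 = dp3 at *
  generalize theta V0 = e0 at *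
  generalize theta V1 = e1 at *
  generalize theta V2 = e2 at *
  exact ⟨(-p1 ^ 3 + 3 * p1 ^ 2 - 2 * p1 * p2 + 2 * p1 + 2 * p3 + 3 * V0 - V1 - V2) * wP +
    2 * (2 * P * p1 ^ 2 + 3 * P * p1 - P * p2 + P) * w1 - 2 * P * p1 * w2 + 2 * P * w3 -
    3 * P * u0 + P * u1 + P * u2 + 2 * P * v, by
    linear_combination
      (-p1 ^ 3 + 3 * p1 ^ 2 - 2 * p1 * p2 + 2 * p1 + 2 * p3 + 3 * V0 - V1 - V2) * hP +
      2 * (2 * P * p1 ^ 2 + 3 * P * p1 - P * p2 + P) * d1 - 2 * P * p1 * d2 + 2 * P * d3 -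
      3 * P * r0 + P * r1 + P * r2 + 2 * P * hv + 3 * P * g2 + 2 * P * g3 - 3 * P * g4 +
      (-36 * P * p1 ^ 4 + 8 * P * p1 ^ 3 - 64 * P * p1 ^ 2 * p2 - P * p1 ^ 2 * dp1 +
      7 * P * p1 ^ 2 + 12 * P * p1 * p2 - 38 * P * p1 * p3 + 3 * P * p1 * V0 - P * p1 * V1 -
      P * p1 * V2 - 2 * P * p1 * dp1 + 4 * P * p1 - 15 * P * p2 ^ 2 + 3 * P * p2 +
      7 * P * p3 + 3 * P * V0 + 3 * P * V1 - 3 * P * V2 - 6 * P * V3 - P * dp1 - P * dp3 +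
      2 * P * e0 - P * e1 - P * e2 - 2 * P * H3 + 10 * P * H4 - p1 ^ 2 * dP - p1 * dP -
      p3 * dP - V0 * dP) * h⟩

end Congruences

end SptCongruences

/-- **Corollary 3.2 (Andrews' congruences):** for every `n ∈ ℕ₀`,
`spt(5n+4) ≡ 0 (mod 5)` and `spt(7n+5) ≡ 0 (mod 7)`. -/
theorem spt_congruences (n : ℕ) :
    spt (5 * n + 4) ≡ 0 [MOD 5] ∧ spt (7 * n + 5) ≡ 0 [MOD 7] := by
  have : Fact (Nat.Prime 5) := ⟨by norm_num⟩
  have : Fact (Nat.Prime 7) := ⟨by norm_num⟩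
  rw [Nat.modEq_zero_iff_dvd, Nat.modEq_zero_iff_dvd, ← ZMod.natCast_eq_zero_iff,
    ← ZMod.natCast_eq_zero_iff]
  exact ⟨SptCongruences.natCast_spt_five_eq_zero (fun h =>
      absurd ((ZMod.natCast_eq_zero_iff 2 5).mp h) (by norm_num)) (ZMod.natCast_self 5) n,
    SptCongruences.natCast_spt_seven_eq_zero (fun h =>
      absurd ((ZMod.natCast_eq_zero_iff 2 7).mp h) (by norm_num)) (ZMod.natCast_self 7) n⟩
end

section
/- For every n ∈ ℕ₀, p̄p̄(3n+2) ≡ 0 (mod 3). -/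
open Finset

/-- An *overpartition*: a partition (a multiset of positive parts) in which the first
occurrence of each part may be overlined. The field `overlined` records the set of part
values whose first occurrence is overlined; it must consist of values actually occurring
as parts. -/
structure Overpartition where
  parts : Multiset ℕ
  parts_pos : ∀ i ∈ parts, 0 < i
  overlined : Finset ℕ
  overlined_mem : ∀ i ∈ overlined, i ∈ parts

namespace Overpartition

/-- The size of an overpartition: the sum of its parts. -/
def size (l : Overpartition) : ℕ := l.parts.sum

end Overpartition


/-- `p̄p̄(n)`: the number of overpartition pairs of `n`. -/
noncomputable def ppbar (n : ℕ) : ℕ :=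
  Nat.card {p : Overpartition × Overpartition // p.1.size + p.2.size = n}

section QPochhammer

open PowerSeries

variable {K : Type*} [Field K]

/-- The finite product `(q; q)_n = ∏_{i = 1}^n (1 - q ^ i)` as a power series in `q`. -/
noncomputable def qPoch (K : Type*) [Field K] (n : ℕ) : K⟦X⟧ :=
  ∏ i ∈ range n, (1 - X ^ (i + 1))

/-- The finite product `(-q; q)_n = ∏_{i = 1}^n (1 + q ^ i)` as a power series in `q`. -/
noncomputable def qPochNeg (K : Type*) [Field K] (n : ℕ) : K⟦X⟧ :=
  ∏ i ∈ range n, (1 + X ^ (i + 1))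

/-- The partial sum `1 + 2 ∑_{k = 1}^n (-1) ^ k q ^ (k ^ 2)` of Gauss's theta series. -/
noncomputable def gaussTheta (K : Type*) [Field K] (n : ℕ) : K⟦X⟧ :=
  1 + 2 * ∑ k ∈ range n, (-1) ^ (k + 1) * X ^ ((k + 1) ^ 2)

/-- The summand `(-1) ^ k q ^ (k ^ 2) / ((q; q)_{n - k} (q; q)_{n + k})`. -/
noncomputable def baileyTerm (K : Type*) [Field K] (n k : ℕ) : K⟦X⟧ :=
  (-1) ^ k * X ^ (k ^ 2) * ((qPoch K (n - k))⁻¹ * (qPoch K (n + k))⁻¹)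

/-- The symmetric sum of `baileyTerm K n k` over `-m ≤ k ≤ m`. -/
noncomputable def baileySum (K : Type*) [Field K] (n m : ℕ) : K⟦X⟧ :=
  baileyTerm K n 0 + 2 * ∑ k ∈ range m, baileyTerm K n (k + 1)

lemma constantCoeff_qPoch (n : ℕ) : constantCoeff (qPoch K n) = 1 := by
  simp [qPoch, map_prod]

lemma constantCoeff_qPochNeg (n : ℕ) : constantCoeff (qPochNeg K n) = 1 := by
  simp [qPochNeg, map_prod]

lemma qPoch_mul_inv (n : ℕ) : qPoch K n * (qPoch K n)⁻¹ = 1 :=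
  PowerSeries.mul_inv_cancel _ (by simp [constantCoeff_qPoch])

lemma qPoch_succ (n : ℕ) : qPoch K (n + 1) = qPoch K n * (1 - X ^ (n + 1)) :=
  prod_range_succ _ _

lemma qPochNeg_succ (n : ℕ) : qPochNeg K (n + 1) = qPochNeg K n * (1 + X ^ (n + 1)) :=
  prod_range_succ _ _

lemma qPoch_inv_eq (n : ℕ) : (qPoch K n)⁻¹ = (qPoch K (n + 1))⁻¹ * (1 - X ^ (n + 1)) := by
  have h := qPoch_mul_inv (K := K) (n + 1)
  rw [qPoch_succ] at h ⊢
  linear_combination (-(qPoch K n)⁻¹) * h +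
    ((qPoch K n * (1 - X ^ (n + 1)))⁻¹ * (1 - X ^ (n + 1))) * qPoch_mul_inv (K := K) n

lemma baileySum_succ_right (n m : ℕ) :
    baileySum K n (m + 1) = baileySum K n m + 2 * baileyTerm K n (m + 1) := by
  simp only [baileySum, sum_range_succ]
  ring

lemma baileySum_telescope (m d : ℕ) :
    (1 - X ^ (2 * (m + d + 1))) * baileySum K (m + d + 1) m - baileySum K (m + d) m =
      2 * ((-1) ^ m * X ^ (m ^ 2 + (m + d + 1) + m) *
        ((qPoch K d)⁻¹ * (qPoch K (2 * m + d + 1))⁻¹)) := by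
  induction m generalizing d with
  | zero =>
    simp only [baileySum, baileyTerm, range_zero, sum_empty, zero_add, add_zero, Nat.sub_zero,
      mul_zero, pow_zero]
    rw [qPoch_inv_eq d]
    ring
  | succ m ih =>
    have h := ih (d + 1)
    have e1 : m + 1 + d + 1 - (m + 1) = d + 1 := by omega
    have e2 : m + 1 + d - (m + 1) = d := by omega
    have e3 : m + 1 + d + 1 + (m + 1) = 2 * m + d + 2 + 1 := by omega
    have e4 : m + 1 + d + (m + 1) = 2 * m + d + 2 := by omega
    have e5 : m + (d + 1) = m + 1 + d := by omega
    have e6 : 2 * m + (d + 1) + 1 = 2 * m + d + 2 := by omega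
    have e7 : 2 * (m + 1) + d + 1 = 2 * m + d + 2 + 1 := by omega
    rw [e5, e6] at h
    rw [baileySum_succ_right, baileySum_succ_right, e7]
    simp only [baileyTerm, e1, e2, e3, e4]
    rw [qPoch_inv_eq (2 * m + d + 2)] at h ⊢
    rw [qPoch_inv_eq d]
    linear_combination h

lemma baileySum_succ (n : ℕ) :
    (1 - X ^ (2 * (n + 1))) * baileySum K (n + 1) (n + 1) = baileySum K n n := by
  have h := baileySum_telescope (K := K) n 0
  have e : n + 1 + (n + 1) = 2 * n + 1 + 1 := by omega
  simp only [add_zero] at h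
  rw [baileySum_succ_right]
  simp only [baileyTerm, Nat.sub_self, e]
  rw [qPoch_inv_eq (2 * n + 1)] at h
  linear_combination h

lemma baileySum_mul (n : ℕ) : baileySum K n n * (qPoch K n * qPochNeg K n) = 1 := by
  induction n with
  | zero =>
    have h : qPoch K 0 = 1 := by simp [qPoch]
    simp [baileySum, baileyTerm, h, qPochNeg]
  | succ n ih =>
    rw [qPoch_succ, qPochNeg_succ]
    linear_combination ih + qPoch K n * qPochNeg K n * baileySum_succ (K := K) n

lemma X_pow_dvd_qPoch_add_sub (a j : ℕ) :
    (X : K⟦X⟧) ^ (a + 1) ∣ qPoch K (a + j) - qPoch K a := by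
  induction j with
  | zero => simp
  | succ j ih =>
    have e : qPoch K (a + (j + 1)) - qPoch K a =
        (qPoch K (a + j) - qPoch K a) - X ^ (a + 1) * (X ^ j * qPoch K (a + j)) := by
      rw [← add_assoc, qPoch_succ]
      ring
    rw [e]
    exact ih.sub (Dvd.intro _ rfl)

lemma X_pow_dvd_sq_mul_baileyTerm_sub {n k : ℕ} (hk : k ≤ n) :
    (X : K⟦X⟧) ^ (n + 1) ∣ qPoch K n ^ 2 * baileyTerm K n k - (-1) ^ k * X ^ (k ^ 2) := by
  obtain ⟨d, rfl⟩ := Nat.exists_eq_add_of_le' hk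
  obtain ⟨u, hu⟩ := X_pow_dvd_qPoch_add_sub (K := K) d k
  obtain ⟨v, hv⟩ := X_pow_dvd_qPoch_add_sub (K := K) (d + k) k
  have h1 := qPoch_mul_inv (K := K) d
  have h2 := qPoch_mul_inv (K := K) (d + k + k)
  obtain ⟨c, hc⟩ : ∃ c, k ^ 2 = k + c :=
    Nat.exists_eq_add_of_le (Nat.le_self_pow two_ne_zero k)
  simp only [baileyTerm, Nat.add_sub_cancel]
  set P := qPoch K (d + k)
  set r := (qPoch K d)⁻¹
  set s := (qPoch K (d + k + k))⁻¹
  rw [hc]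
  refine ⟨(-1) ^ k * X ^ c * (u * r * (P * s) - X ^ k * v * s), ?_⟩
  linear_combination (-1) ^ k * X ^ (k + c) *
    (P * s * r * hu + P * s * h1 - s * hv + h2)

lemma X_pow_dvd_sq_mul_baileySum_sub (n : ℕ) :
    (X : K⟦X⟧) ^ (n + 1) ∣ qPoch K n ^ 2 * baileySum K n n - gaussTheta K n := by
  have e : qPoch K n ^ 2 * baileySum K n n - gaussTheta K n =
      (qPoch K n ^ 2 * baileyTerm K n 0 - (-1) ^ 0 * X ^ (0 ^ 2)) +
      2 * ∑ k ∈ range n,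
        (qPoch K n ^ 2 * baileyTerm K n (k + 1) - (-1) ^ (k + 1) * X ^ ((k + 1) ^ 2)) := by
    rw [sum_sub_distrib, ← mul_sum, baileySum, gaussTheta]
    ring
  rw [e]
  refine (X_pow_dvd_sq_mul_baileyTerm_sub n.zero_le).add (Dvd.dvd.mul_left (dvd_sum ?_) _)
  exact fun k hk ↦ X_pow_dvd_sq_mul_baileyTerm_sub (mem_range.mp hk)

/-- A truncated form of Gauss's identity
`∑_{k ∈ ℤ} (-1) ^ k q ^ (k ^ 2) = (q; q)_∞ / (-q; q)_∞`. -/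
lemma X_pow_dvd_gaussTheta_mul_sub (n : ℕ) :
    (X : K⟦X⟧) ^ (n + 1) ∣ gaussTheta K n * qPochNeg K n - qPoch K n := by
  obtain ⟨c, hc⟩ := X_pow_dvd_sq_mul_baileySum_sub (K := K) n
  refine ⟨-c * qPochNeg K n, ?_⟩
  linear_combination (-qPochNeg K n) * hc + qPoch K n * baileySum_mul (K := K) n

end QPochhammer

section GeneratingFunction

open PowerSeries
open scoped PowerSeries.WithPiTopology

/-- An overpartition of `n` is a partition of `n` with a set of distinguished part sizes. -/
def Overpartition.equivSigma (n : ℕ) :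
    {l : Overpartition // l.size = n} ≃
      (p : n.Partition) × {s : Finset ℕ // s ∈ p.parts.toFinset.powerset} where
  toFun l := ⟨⟨l.1.parts, fun {i} hi ↦ l.1.parts_pos i hi, l.2⟩, l.1.overlined, by
    simpa [Finset.subset_iff] using l.1.overlined_mem⟩
  invFun x := ⟨⟨x.1.parts, fun i hi ↦ x.1.parts_pos hi, x.2.1, fun i hi ↦ by
    simpa using mem_powerset.mp x.2.2 hi⟩, x.1.parts_sum⟩
  left_inv _ := rfl
  right_inv _ := rfl

instance (n : ℕ) : Finite {l : Overpartition // l.size = n} :=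
  .of_equiv _ (Overpartition.equivSigma n).symm

/-- Overpartition pairs of `n`, sorted by the sizes of the two components. -/
def Overpartition.pairEquivSigma (n : ℕ) :
    {p : Overpartition × Overpartition // p.1.size + p.2.size = n} ≃
      (x : {x : ℕ × ℕ // x ∈ antidiagonal n}) ×
        ({l : Overpartition // l.size = x.1.1} × {l : Overpartition // l.size = x.1.2}) where
  toFun p := ⟨⟨(p.1.1.size, p.1.2.size), mem_antidiagonal.mpr p.2⟩, ⟨p.1.1, rfl⟩, ⟨p.1.2, rfl⟩⟩
  invFun y := ⟨(y.2.1.1, y.2.2.1), by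
    rw [y.2.1.2, y.2.2.2]
    exact mem_antidiagonal.mp y.1.2⟩
  left_inv _ := rfl
  right_inv := by
    rintro ⟨⟨⟨a, b⟩, h⟩, ⟨l, hl⟩, ⟨m, hm⟩⟩
    dsimp only at hl hm
    subst hl hm
    rfl

/-- The generating function of overpartitions. -/
noncomputable def overpartitionGenFun (R : Type*) [CommSemiring R] : R⟦X⟧ :=
  Nat.Partition.genFun fun _ _ ↦ 2

lemma coeff_overpartitionGenFun (R : Type*) [CommSemiring R] (n : ℕ) :
    coeff n (overpartitionGenFun R) = (Nat.card {l : Overpartition // l.size = n} : R) := by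
  rw [Nat.card_congr (Overpartition.equivSigma n), Nat.card_sigma, overpartitionGenFun,
    Nat.Partition.coeff_genFun]
  simp [Finsupp.prod, -mem_powerset]

lemma coeff_sq_overpartitionGenFun (R : Type*) [CommSemiring R] (n : ℕ) :
    coeff n (overpartitionGenFun R ^ 2) = (ppbar n : R) := by
  rw [ppbar, Nat.card_congr (Overpartition.pairEquivSigma n), Nat.card_sigma, pow_two, coeff_mul,
    ← sum_coe_sort (antidiagonal n)]
  simp [coeff_overpartitionGenFun, Nat.card_prod]

lemma one_add_tsum_mul_one_sub_X_pow {R : Type*} [CommRing R] [TopologicalSpace R] [T2Space R]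
    [IsTopologicalRing R] (i : ℕ) :
    (1 + ∑' j : ℕ, (2 : R) • (X : R⟦X⟧) ^ ((i + 1) * (j + 1))) * (1 - X ^ (i + 1)) =
      1 + X ^ (i + 1) := by
  have h0 : constantCoeff ((X : R⟦X⟧) ^ (i + 1)) = 0 := by simp
  have hs := WithPiTopology.summable_pow_of_constantCoeff_eq_zero h0
  have h := WithPiTopology.tsum_pow_mul_one_sub_of_constantCoeff_eq_zero h0
  have e : ∑' j : ℕ, (2 : R) • (X : R⟦X⟧) ^ ((i + 1) * (j + 1)) =
      2 * X ^ (i + 1) * ∑' j : ℕ, (X ^ (i + 1)) ^ j := by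
    rw [← hs.tsum_mul_left]
    refine tsum_congr fun j ↦ ?_
    rw [two_smul, pow_mul]
    ring
  rw [e]
  linear_combination 2 * X ^ (i + 1) * h

lemma exists_X_pow_dvd_overpartitionGenFun_mul_sub (K : Type*) [Field K] (d : ℕ) :
    ∃ N ≥ d, (X : K⟦X⟧) ^ (d + 1) ∣ overpartitionGenFun K * qPoch K N - qPochNeg K N := by
  let _ : TopologicalSpace K := ⊥
  have : DiscreteTopology K := ⟨rfl⟩
  have h := (Nat.Partition.hasProd_genFun (R := K) fun _ _ ↦ 2).tendsto_prod_nat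
  rw [WithPiTopology.tendsto_iff_coeff_tendsto] at h
  simp only [nhds_discrete, Filter.tendsto_pure] at h
  obtain ⟨N, hN, hd⟩ := (((Filter.eventually_all_finset (range (d + 1))).mpr
    fun m _ ↦ h m).and (Filter.eventually_ge_atTop d)).exists
  refine ⟨N, hd, ?_⟩
  set F : K⟦X⟧ := ∏ i ∈ range N, (1 + ∑' j : ℕ, (2 : K) • X ^ ((i + 1) * (j + 1)))
  have hF : F * qPoch K N = qPochNeg K N := by
    rw [qPoch, qPochNeg, ← prod_mul_distrib]
    exact prod_congr rfl fun i _ ↦ one_add_tsum_mul_one_sub_X_pow i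
  rw [← hF, ← sub_mul]
  refine Dvd.dvd.mul_right (X_pow_dvd_iff.mpr fun m hm ↦ ?_) _
  rw [map_sub, hN m (mem_range.mpr hm), overpartitionGenFun, sub_self]

lemma exists_X_pow_dvd_overpartitionGenFun_mul_gaussTheta_sub (K : Type*) [Field K] (d : ℕ) :
    ∃ N, (X : K⟦X⟧) ^ (d + 1) ∣ overpartitionGenFun K * gaussTheta K N - 1 := by
  obtain ⟨N, hN, u, hu⟩ := exists_X_pow_dvd_overpartitionGenFun_mul_sub K d
  obtain ⟨v, hv⟩ := (pow_dvd_pow X (add_le_add_left hN 1)).trans (X_pow_dvd_gaussTheta_mul_sub (K := K) N)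
  have h1 := qPoch_mul_inv (K := K) N
  have h2 : qPochNeg K N * (qPochNeg K N)⁻¹ = 1 :=
    PowerSeries.mul_inv_cancel _ (by simp [constantCoeff_qPochNeg])
  refine ⟨N, (qPoch K N)⁻¹ * (qPochNeg K N)⁻¹ *
    (u * (gaussTheta K N * qPochNeg K N) + qPochNeg K N * v), ?_⟩
  set P := qPoch K N
  set Q := qPochNeg K N
  set G := overpartitionGenFun K
  set S := gaussTheta K N
  linear_combination (P⁻¹ * Q⁻¹ * S * Q) * hu + P⁻¹ * Q⁻¹ * Q * hv +
    (1 - G * S) * (Q * Q⁻¹ * h1 + h2)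

end GeneratingFunction

lemma coeff_pow_char_of_not_dvd {R : Type*} [CommRing R] [NoZeroDivisors R] (p : ℕ) [CharP R p]
    (f : PowerSeries R) {n : ℕ} (hn : ¬ p ∣ n) : PowerSeries.coeff n (f ^ p) = 0 := by
  obtain ⟨m, rfl⟩ := Nat.exists_eq_succ_of_ne_zero (n := n) (by rintro rfl; exact hn (dvd_zero p))
  have h := congrArg (PowerSeries.coeff m) (PowerSeries.derivative_pow (R := R) f p)
  have hp : (p : PowerSeries R) = 0 := by
    rw [← map_natCast (PowerSeries.C (R := R)), CharP.cast_eq_zero, map_zero]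
  rw [PowerSeries.coeff_derivative, hp, zero_mul, zero_mul, map_zero] at h
  refine (mul_eq_zero.mp h).resolve_right fun h' ↦ hn ?_
  exact (CharP.cast_eq_zero_iff R p (m + 1)).mp (by exact_mod_cast h')

lemma coeff_cube_mul_gaussTheta (f : PowerSeries (ZMod 3)) (n N : ℕ) :
    PowerSeries.coeff (3 * n + 2) (f ^ 3 * gaussTheta (ZMod 3) N) = 0 := by
  have key (k : ℕ) : PowerSeries.coeff (3 * n + 2) (f ^ 3 * PowerSeries.X ^ (k ^ 2)) = 0 := by
    rw [PowerSeries.coeff_mul_X_pow']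
    split_ifs with h
    · refine coeff_pow_char_of_not_dvd 3 f fun hdvd ↦ ?_
      have hk : k ^ 2 % 3 = 0 ∨ k ^ 2 % 3 = 1 := by
        rw [Nat.pow_mod]
        have := Nat.mod_lt k three_pos
        interval_cases k % 3 <;> simp
      omega
    · rfl
  have e : f ^ 3 * gaussTheta (ZMod 3) N = f ^ 3 * PowerSeries.X ^ (0 ^ 2) +
      ∑ k ∈ range N, PowerSeries.C (2 * (-1) ^ (k + 1)) *
        (f ^ 3 * PowerSeries.X ^ ((k + 1) ^ 2)) := by
    rw [gaussTheta, mul_add, mul_sum, mul_sum]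
    refine congrArg₂ _ (by simp) (sum_congr rfl fun k _ ↦ ?_)
    simp only [map_mul, map_pow, map_neg, map_one, map_ofNat]
    ring
  rw [e, map_add, key, map_sum, zero_add]
  exact sum_eq_zero fun k _ ↦ by rw [PowerSeries.coeff_C_mul, key, mul_zero]

/-- **Corollary 3.4 (Bringmann--Lovejoy congruence):** for every `n ∈ ℕ₀`,
`p̄p̄(3n+2) ≡ 0 (mod 3)`. -/
theorem ppbar_congruence (n : ℕ) : ppbar (3 * n + 2) ≡ 0 [MOD 3] := by
  obtain ⟨N, h⟩ := exists_X_pow_dvd_overpartitionGenFun_mul_gaussTheta_sub (ZMod 3) (3 * n + 2)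
  have h0 := PowerSeries.X_pow_dvd_iff.mp
    (Dvd.dvd.mul_left h (overpartitionGenFun (ZMod 3) ^ 2)) (3 * n + 2) (Nat.lt_succ_self _)
  rw [mul_sub, ← mul_assoc, ← pow_succ, mul_one, map_sub, coeff_cube_mul_gaussTheta, zero_sub,
    neg_eq_zero, coeff_sq_overpartitionGenFun] at h0
  exact (Nat.modEq_zero_iff_dvd).mpr ((ZMod.natCast_eq_zero_iff _ _).mp h0)
end
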